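/- There exists a constant c > 0 such that for almost every α ∈ [0,1) there are infinitely many n ∈ ℕ satisfying simultaneously: G(n) ≥ c·n·(log n)^{1/4}/(log log n) and ‖nα‖ ≤ 1/(n·(log n)^{0.9}). -/

import Mathlib

open Real MeasureTheory Filter Finset
open scoped Classical

/-- `n` is a sum of two squares. -/
def IsSumTwoSquares (n : ℕ) : Prop := ∃ x y : ℤ, (n : ℤ) = x ^ 2 + y ^ 2

/-- Indicator function of the sums of two squares. -/
noncomputable def b (n : ℕ) : ℕ := if IsSumTwoSquares n then 1 else 0

/-- Distance to the nearest integer. -/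
noncomputable def nint (x : ℝ) : ℝ := |x - round x|

/-- `G n = Σ_{1 ≤ k ≤ (log n)^{5/8}} Σ_{1 ≤ m ≤ n (log n)^{5/8}} b(m)·b(m + nk)`. -/
noncomputable def G (n : ℕ) : ℕ :=
  ∑ k ∈ Finset.Icc 1 ⌊Real.log n ^ ((5:ℝ)/8)⌋₊,
    ∑ m ∈ Finset.Icc 1 ⌊(n : ℝ) * Real.log n ^ ((5:ℝ)/8)⌋₊,
      b m * b (m + n * k)

theorem sum_sum_divisors_eq (f : ℕ → ℕ → ℝ) (N : ℕ) :
    ∑ n ∈ Icc 1 N, ∑ d ∈ n.divisors, f d (n / d) =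
      ∑ d ∈ Icc 1 N, ∑ m ∈ Icc 1 (N / d), f d m := by
  rw [Finset.sum_sigma', Finset.sum_sigma']
  refine Finset.sum_bij' (fun p _ => ⟨p.2, p.1 / p.2⟩) (fun p _ => ⟨p.1 * p.2, p.1⟩) ?_ ?_ ?_ ?_ ?_
  · rintro ⟨n, d⟩ h
    simp only [mem_sigma, mem_Icc, Nat.mem_divisors] at h ⊢
    obtain ⟨⟨h1, h2⟩, h3, h4⟩ := h
    have hd := Nat.pos_of_dvd_of_pos h3 h1
    exact ⟨⟨hd, (Nat.le_of_dvd h1 h3).trans h2⟩, Nat.div_pos (Nat.le_of_dvd h1 h3) hd,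
      Nat.div_le_div_right h2⟩
  · rintro ⟨d, m⟩ h
    simp only [mem_sigma, mem_Icc, Nat.mem_divisors] at h ⊢
    obtain ⟨⟨h1, h2⟩, h3, h4⟩ := h
    have : d * m ≤ N := by
      rw [mul_comm]; exact (Nat.le_div_iff_mul_le h1).1 h4
    have h5 : 0 < d * m := Nat.mul_pos h1 h3
    exact ⟨⟨h5, this⟩, dvd_mul_right _ _, h5.ne'⟩
  · rintro ⟨n, d⟩ h
    simp only [mem_sigma, mem_Icc, Nat.mem_divisors] at h ⊢
    rw [Nat.mul_div_cancel' h.2.1]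
  · rintro ⟨d, m⟩ h
    simp only [mem_sigma, mem_Icc] at h ⊢
    rw [Nat.mul_div_cancel_left _ h.1.1]
  · rintro ⟨n, d⟩ h
    rfl

theorem abs_log_factorial_sub_le (N : ℕ) :
    |Real.log (N.factorial) - N * Real.log N| ≤ N := by
  rcases Nat.eq_zero_or_pos N with rfl | hN
  · simp
  have hN' : (0 : ℝ) < N := by exact_mod_cast hN
  have hf : (0 : ℝ) < N.factorial := by exact_mod_cast N.factorial_pos
  have h1 : Real.log N.factorial ≤ N * Real.log N := by
    rw [← Real.log_pow]
    exact Real.log_le_log hf (by exact_mod_cast Nat.factorial_le_pow N)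
  have h2 : N * Real.log N - Real.log N.factorial ≤ N := by
    rw [← Real.log_pow, ← Real.log_div (by positivity) (by positivity), Real.log_le_iff_le_exp
      (by positivity)]
    exact Real.pow_div_factorial_le_exp _ hN'.le N
  rw [abs_le]; constructor <;> linarith

theorem sum_log_eq_log_factorial (N : ℕ) :
    ∑ n ∈ Icc 1 N, Real.log n = Real.log N.factorial := by
  induction N with
  | zero => simp
  | succ k ih =>
    rw [Finset.sum_Icc_succ_top (by omega), ih, Nat.factorial_succ, Nat.cast_mul,
      Real.log_mul (by positivity) (by positivity)]
    ring

open ArithmeticFunction in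
theorem sum_vonMangoldt_le (N : ℕ) :
    ∑ n ∈ Icc 1 N, vonMangoldt n ≤ (Real.log 4 + 4) * N := by
  have h := Chebyshev.psi_le_const_mul_self (x := N) (by positivity)
  rw [Chebyshev.psi_eq_sum_Icc, Nat.floor_natCast] at h
  refine le_trans (Finset.sum_le_sum_of_subset_of_nonneg ?_ ?_) h
  · exact Finset.Icc_subset_Icc_left (by norm_num)
  · intros; exact vonMangoldt_nonneg

open ArithmeticFunction in
/-- Mertens' first theorem for the von Mangoldt function. -/
theorem exists_abs_sum_vonMangoldt_div_sub_log_le :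
    ∃ C : ℝ, 0 ≤ C ∧ ∀ N : ℕ, 1 ≤ N → |∑ n ∈ Icc 1 N, vonMangoldt n / n - Real.log N| ≤ C := by
  refine ⟨Real.log 4 + 5, by positivity, fun N hN => ?_⟩
  have hNpos : (0 : ℝ) < N := by exact_mod_cast hN
  have h1 : ∑ n ∈ Icc 1 N, Real.log n =
      ∑ d ∈ Icc 1 N, vonMangoldt d * ((N / d : ℕ) : ℝ) := by
    have := sum_sum_divisors_eq (fun d _ => vonMangoldt d) N
    simp only [vonMangoldt_sum] at this
    rw [this]
    refine Finset.sum_congr rfl fun d _ => ?_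
    simp [mul_comm]
  have h2 : |N * ∑ n ∈ Icc 1 N, vonMangoldt n / n - ∑ n ∈ Icc 1 N, Real.log n| ≤
      (Real.log 4 + 4) * N := by
    rw [h1, Finset.mul_sum, ← Finset.sum_sub_distrib]
    refine (Finset.abs_sum_le_sum_abs _ _).trans (le_trans ?_ (sum_vonMangoldt_le N))
    refine Finset.sum_le_sum fun d hd => ?_
    have hd1 : (0 : ℝ) < d := by exact_mod_cast (mem_Icc.1 hd).1
    have e : (N : ℝ) * (vonMangoldt d / d) - vonMangoldt d * ((N / d : ℕ) : ℝ) =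
        vonMangoldt d * ((N : ℝ) / d - ((N / d : ℕ) : ℝ)) := by ring
    rw [e, abs_mul, abs_of_nonneg vonMangoldt_nonneg]
    refine mul_le_of_le_one_right vonMangoldt_nonneg ?_
    have a1 : ((N / d : ℕ) : ℝ) ≤ (N : ℝ) / d := Nat.cast_div_le
    have a2 : (N : ℝ) / d < ((N / d : ℕ) : ℝ) + 1 := by
      rw [← Nat.floor_div_eq_div (K := ℝ)]
      exact Nat.lt_floor_add_one _
    rw [abs_le]; constructor <;> linarith
  have h3 := abs_log_factorial_sub_le N
  rw [← sum_log_eq_log_factorial] at h3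
  have h4 : N * |∑ n ∈ Icc 1 N, vonMangoldt n / n - Real.log N| ≤ N * (Real.log 4 + 5) := by
    rw [← abs_of_pos hNpos, ← abs_mul, abs_of_pos hNpos]
    rw [abs_le] at *
    constructor <;> nlinarith
  exact le_of_mul_le_mul_left h4 hNpos

/-- The non-principal Dirichlet character modulo `4`, with real values. -/
noncomputable def chi (n : ℕ) : ℝ := ((ZMod.χ₄ (n : ZMod 4) : ℤ) : ℝ)

theorem chi_mul (m n : ℕ) : chi (m * n) = chi m * chi n := by
  rw [chi, chi, chi, Nat.cast_mul, map_mul, Int.cast_mul]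

theorem chi_eq_ite (n : ℕ) :
    chi n = if n % 2 = 0 then 0 else if n % 4 = 1 then 1 else -1 := by
  rw [chi, ZMod.χ₄_nat_eq_if_mod_four]
  split_ifs <;> simp

theorem abs_chi_le_one (n : ℕ) : |chi n| ≤ 1 := by
  rw [chi_eq_ite]; split_ifs <;> simp

/-- The partial sums of `chi`. -/
noncomputable def chiSum (n : ℕ) : ℝ := if n % 4 = 1 ∨ n % 4 = 2 then 1 else 0

theorem chi_succ (n : ℕ) : chi (n + 1) = chiSum (n + 1) - chiSum n := by
  rw [chi_eq_ite, chiSum, chiSum]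
  have : n % 4 = 0 ∨ n % 4 = 1 ∨ n % 4 = 2 ∨ n % 4 = 3 := by omega
  rcases this with h | h | h | h
  · rw [if_neg (by omega), if_pos (by omega), if_pos (by omega), if_neg (by omega)]; simp
  · rw [if_pos (by omega), if_pos (by omega), if_pos (by omega)]; simp
  · rw [if_neg (by omega), if_neg (by omega), if_neg (by omega), if_pos (by omega)]; simp
  · rw [if_pos (by omega), if_neg (by omega), if_neg (by omega)]; simp

theorem chiSum_nonneg (n : ℕ) : 0 ≤ chiSum n := by
  rw [chiSum]; split_ifs <;> simp

theorem chiSum_le_one (n : ℕ) : chiSum n ≤ 1 := by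
  rw [chiSum]; split_ifs <;> simp

theorem abs_sum_Ioc_chi_mul_le (f : ℕ → ℝ) (k N : ℕ) (hkN : k ≤ N) (h0 : ∀ n, 0 ≤ f n)
    (hf : ∀ n, k < n → f (n + 1) ≤ f n) :
    |∑ n ∈ Ioc k N, chi n * f n| ≤ f (k + 1) := by
  have key : 0 ≤ ∑ n ∈ Ioc k N, chi n * f n - chiSum N * f (N + 1) + chiSum k * f (k + 1) ∧
      ∑ n ∈ Ioc k N, chi n * f n - chiSum N * f (N + 1) + chiSum k * f (k + 1) ≤
        f (k + 1) - f (N + 1) := by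
    induction N, hkN using Nat.le_induction with
    | base => simp
    | succ N hN ih =>
      rw [Finset.sum_Ioc_succ_top (by omega), chi_succ]
      have h1 := hf (N + 1) (by omega)
      have h2 := chiSum_nonneg (N + 1)
      have h3 := chiSum_le_one (N + 1)
      constructor
      · nlinarith [ih.1]
      · nlinarith [ih.2]
  have h1 := chiSum_nonneg N
  have h2 := chiSum_le_one N
  have h3 := chiSum_nonneg k
  have h4 := chiSum_le_one k
  have h5 := h0 (N + 1)
  have h6 := h0 (k + 1)
  rw [abs_le]
  constructor <;> nlinarith [key.1, key.2]

/-- Partial sums of the Dirichlet series of `chi` at `1`. -/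
noncomputable def chiHarmonic (N : ℕ) : ℝ := ∑ n ∈ Icc 1 N, chi n * (1 / n)

theorem sum_Icc_eq_add_sum_Ioc (f : ℕ → ℝ) {k N : ℕ} (h : k ≤ N) :
    ∑ n ∈ Icc 1 N, f n = ∑ n ∈ Icc 1 k, f n + ∑ n ∈ Ioc k N, f n := by
  rw [← Finset.sum_union]
  · congr 1
    ext x; simp only [mem_union, mem_Icc, mem_Ioc]; omega
  · rw [Finset.disjoint_left]
    intro x hx hx'
    simp only [mem_Icc, mem_Ioc] at hx hx'; omega

theorem abs_chiHarmonic_sub_le {k N : ℕ} (h : k ≤ N) :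
    |chiHarmonic N - chiHarmonic k| ≤ 1 / (k + 1) := by
  rw [chiHarmonic, chiHarmonic, sum_Icc_eq_add_sum_Ioc _ h, add_sub_cancel_left]
  refine (abs_sum_Ioc_chi_mul_le (fun n => 1 / (n : ℝ)) k N h (fun n => by positivity) ?_).trans
    (by simp)
  intro n hn
  have : (0 : ℝ) < n := by exact_mod_cast (by omega : 0 < n)
  push_cast
  gcongr
  linarith

theorem half_le_chiHarmonic {N : ℕ} (h : 1 ≤ N) : 1 / 2 ≤ chiHarmonic N := by
  have h1 := abs_chiHarmonic_sub_le h
  have h2 : chiHarmonic 1 = 1 := by simp [chiHarmonic, chi_eq_ite]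
  rw [h2, abs_le] at h1
  norm_num at h1
  linarith [h1.1]

theorem abs_sum_chi_mul_log_div_le (N : ℕ) :
    |∑ n ∈ Icc 1 N, chi n * (Real.log n / n)| ≤ 2 := by
  rcases le_or_gt 2 N with h | h
  · rw [sum_Icc_eq_add_sum_Ioc _ h]
    have h0 : ∑ n ∈ Icc 1 2, chi n * (Real.log n / n) = 0 := by
      rw [Finset.sum_Icc_succ_top (by norm_num)]
      simp [chi_eq_ite]
    rw [h0, zero_add]
    refine (abs_sum_Ioc_chi_mul_le (fun n => Real.log n / (n : ℝ)) 2 N h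
      (fun n => div_nonneg (Real.log_natCast_nonneg n) (by positivity)) ?_).trans ?_
    · intro n hn
      have hn3 : (3 : ℝ) ≤ n := by exact_mod_cast hn
      have he : Real.exp 1 ≤ 3 := by linarith [Real.exp_one_lt_d9]
      refine Real.log_div_self_antitoneOn (Set.mem_Ici.2 (by linarith))
        (Set.mem_Ici.2 (by push_cast; linarith)) (by push_cast; linarith)
    · have := Real.log_le_sub_one_of_pos (show (0 : ℝ) < 3 by norm_num)
      norm_num
      rw [div_le_iff₀ (by norm_num)]
      linarith
  · have : N = 0 ∨ N = 1 := by omega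
    rcases this with rfl | rfl <;> simp

open ArithmeticFunction in
theorem exists_abs_sum_chi_mul_vonMangoldt_div_le :
    ∃ C : ℝ, 0 ≤ C ∧ ∀ N : ℕ, 1 ≤ N → |∑ n ∈ Icc 1 N, chi n * (vonMangoldt n / n)| ≤ C := by
  refine ⟨2 * (Real.log 4 + 6), by positivity, fun N hN => ?_⟩
  have hN' : (0 : ℝ) < N := by exact_mod_cast hN
  have h1 : ∑ n ∈ Icc 1 N, chi n * (Real.log n / n) =
      ∑ d ∈ Icc 1 N, chi d * (vonMangoldt d / d) * chiHarmonic (N / d) := by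
    simp only [chiHarmonic, Finset.mul_sum]
    rw [← sum_sum_divisors_eq (fun d m => chi d * (vonMangoldt d / d) * (chi m * (1 / m))) N]
    refine Finset.sum_congr rfl fun n hn => ?_
    have hn1 : 1 ≤ n := (mem_Icc.1 hn).1
    rw [← vonMangoldt_sum, Finset.sum_div, Finset.mul_sum]
    refine Finset.sum_congr rfl fun d hd => ?_
    have hd' := Nat.mem_divisors.1 hd
    obtain ⟨m, rfl⟩ := hd'.1
    have hd0 : 0 < d := Nat.pos_of_ne_zero (by rintro rfl; simp at hn1)
    rw [Nat.mul_div_cancel_left _ hd0, chi_mul]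
    push_cast
    have hm0 : m ≠ 0 := by rintro rfl; simp at hn1
    field_simp
  have h2 : |chiHarmonic N * ∑ n ∈ Icc 1 N, chi n * (vonMangoldt n / n) -
      ∑ n ∈ Icc 1 N, chi n * (Real.log n / n)| ≤ Real.log 4 + 4 := by
    rw [h1, Finset.mul_sum, ← Finset.sum_sub_distrib]
    have h3 : ∑ n ∈ Icc 1 N, vonMangoldt n / N ≤ Real.log 4 + 4 := by
      rw [← Finset.sum_div, div_le_iff₀ hN']
      exact sum_vonMangoldt_le N
    refine (Finset.abs_sum_le_sum_abs _ _).trans (le_trans ?_ h3)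
    refine Finset.sum_le_sum fun d hd => ?_
    have hd1 : (0 : ℝ) < d := by exact_mod_cast (mem_Icc.1 hd).1
    have e : chiHarmonic N * (chi d * (vonMangoldt d / d)) -
        chi d * (vonMangoldt d / d) * chiHarmonic (N / d) =
        chi d * ((vonMangoldt d / d) * (chiHarmonic N - chiHarmonic (N / d))) := by ring
    rw [e, abs_mul, abs_mul, abs_of_nonneg (div_nonneg vonMangoldt_nonneg hd1.le)]
    have a1 := abs_chiHarmonic_sub_le (Nat.div_le_self N d)
    have a2 : (N : ℝ) / d < ((N / d : ℕ) : ℝ) + 1 := by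
      rw [← Nat.floor_div_eq_div (K := ℝ)]
      exact Nat.lt_floor_add_one _
    have a3 : 1 / (((N / d : ℕ) : ℝ) + 1) ≤ d / N := by
      rw [← one_div_div (N : ℝ) d]
      exact one_div_le_one_div_of_le (by positivity) a2.le
    calc _ ≤ 1 * (vonMangoldt d / d * (d / N)) := by
          gcongr
          · exact abs_chi_le_one d
          · exact a1.trans a3
      _ = vonMangoldt d / N := by field_simp
  have h4 := abs_sum_chi_mul_log_div_le N
  have h5 := half_le_chiHarmonic hN
  set A := ∑ n ∈ Icc 1 N, chi n * (vonMangoldt n / n)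
  have h6 : |chiHarmonic N * A| ≤ Real.log 4 + 6 := by
    rw [abs_le] at *
    constructor <;> linarith
  rw [abs_mul, abs_of_nonneg (by linarith)] at h6
  nlinarith [abs_nonneg A]

/-- The weight `Λ(n)(1 + χ₄(n))/2`, supported on prime powers that are sums of two squares. -/
noncomputable def weight (n : ℕ) : ℝ := ArithmeticFunction.vonMangoldt n * ((1 + chi n) / 2)

theorem weight_nonneg (n : ℕ) : 0 ≤ weight n := by
  have := abs_le.1 (abs_chi_le_one n)
  exact mul_nonneg ArithmeticFunction.vonMangoldt_nonneg (by linarith)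

theorem weight_le (n : ℕ) : weight n ≤ ArithmeticFunction.vonMangoldt n := by
  have := abs_le.1 (abs_chi_le_one n)
  exact mul_le_of_le_one_right ArithmeticFunction.vonMangoldt_nonneg (by linarith)

theorem exists_abs_sum_weight_div_sub_log_le :
    ∃ C : ℝ, 0 ≤ C ∧ ∀ N : ℕ, 1 ≤ N →
      |∑ n ∈ Icc 1 N, weight n / n - Real.log N / 2| ≤ C := by
  obtain ⟨C₁, hC₁, h₁⟩ := exists_abs_sum_vonMangoldt_div_sub_log_le
  obtain ⟨C₂, hC₂, h₂⟩ := exists_abs_sum_chi_mul_vonMangoldt_div_le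
  refine ⟨(C₁ + C₂) / 2, by positivity, fun N hN => ?_⟩
  have e : ∑ n ∈ Icc 1 N, weight n / n = (∑ n ∈ Icc 1 N, ArithmeticFunction.vonMangoldt n / n +
      ∑ n ∈ Icc 1 N, chi n * (ArithmeticFunction.vonMangoldt n / n)) / 2 := by
    rw [← Finset.sum_add_distrib, Finset.sum_div]
    refine Finset.sum_congr rfl fun n _ => ?_
    rw [weight]; ring
  have a1 := h₁ N hN
  have a2 := h₂ N hN
  rw [e]
  rw [abs_le] at *
  constructor <;> linarith

theorem exists_le_sum_weight :
    ∃ c : ℝ, 0 < c ∧ ∃ N₀ : ℕ, 1 ≤ N₀ ∧ ∀ N : ℕ, N₀ ≤ N → c * N ≤ ∑ n ∈ Icc 1 N, weight n := by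
  obtain ⟨C, hC, h⟩ := exists_abs_sum_weight_div_sub_log_le
  set D : ℕ := ⌈Real.exp (2 * (2 * C + 1))⌉₊ with hD
  have hDe : Real.exp (2 * (2 * C + 1)) ≤ D := Nat.le_ceil _
  have hD0 : (0 : ℝ) < D := (Real.exp_pos _).trans_le hDe
  have hD1 : 0 < D := by exact_mod_cast hD0
  refine ⟨1 / (2 * D), by positivity, D, hD1, fun N hN => ?_⟩
  have hN0 : (0 : ℝ) < N := by exact_mod_cast hD1.trans_le hN
  have hk1 : 1 ≤ N / D := Nat.div_pos hN hD1
  have hk1' : (1 : ℝ) ≤ ((N / D : ℕ) : ℝ) := by exact_mod_cast hk1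
  have hkN : N / D ≤ N := Nat.div_le_self _ _
  have hkle : ((N / D : ℕ) : ℝ) ≤ (N : ℝ) / D := Nat.cast_div_le
  have hlt : (N : ℝ) / D < ((N / D : ℕ) : ℝ) + 1 := by
    rw [← Nat.floor_div_eq_div (K := ℝ)]
    exact Nat.lt_floor_add_one _
  have hlog : Real.log ((N / D : ℕ) : ℝ) ≤ Real.log N - 2 * (2 * C + 1) := by
    have h1 : 2 * (2 * C + 1) ≤ Real.log D := (Real.le_log_iff_exp_le hD0).2 hDe
    have h2 := Real.log_le_log (by linarith) hkle
    rw [Real.log_div hN0.ne' hD0.ne'] at h2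
    linarith
  have hsum : 1 ≤ ∑ n ∈ Ioc (N / D) N, weight n / n := by
    have h1 := abs_le.1 (h N (hk1.trans hkN))
    have h2 := abs_le.1 (h (N / D) hk1)
    rw [sum_Icc_eq_add_sum_Ioc _ hkN] at h1
    linarith [h1.1, h2.2]
  have hfin : ((N / D : ℕ) : ℝ) * ∑ n ∈ Ioc (N / D) N, weight n / n ≤
      ∑ n ∈ Icc 1 N, weight n := by
    rw [Finset.mul_sum, sum_Icc_eq_add_sum_Ioc _ hkN]
    have h1 : 0 ≤ ∑ n ∈ Icc 1 (N / D), weight n := Finset.sum_nonneg fun _ _ => weight_nonneg _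
    have h2 : ∑ n ∈ Ioc (N / D) N, ((N / D : ℕ) : ℝ) * (weight n / n) ≤
        ∑ n ∈ Ioc (N / D) N, weight n := by
      refine Finset.sum_le_sum fun n hn => ?_
      have hn1 : ((N / D : ℕ) : ℝ) < n := by exact_mod_cast (mem_Ioc.1 hn).1
      rw [mul_div_assoc', div_le_iff₀ (by linarith), mul_comm]
      exact mul_le_mul_of_nonneg_left hn1.le (weight_nonneg n)
    linarith
  have hfin2 : ((N / D : ℕ) : ℝ) ≤ ∑ n ∈ Icc 1 N, weight n := by nlinarith
  refine le_trans ?_ hfin2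
  have : (N : ℝ) / D ≤ 2 * ((N / D : ℕ) : ℝ) := by linarith
  calc 1 / (2 * (D : ℝ)) * N = (N : ℝ) / D / 2 := by field_simp
    _ ≤ _ := by linarith

theorem isSumTwoSquares_iff (n : ℕ) : IsSumTwoSquares n ↔ ∃ x y : ℕ, n = x ^ 2 + y ^ 2 := by
  constructor
  · rintro ⟨x, y, h⟩
    refine ⟨x.natAbs, y.natAbs, ?_⟩
    zify
    simpa using h
  · rintro ⟨x, y, h⟩
    exact ⟨x, y, by exact_mod_cast h⟩

theorem IsSumTwoSquares.mul {m n : ℕ} (hm : IsSumTwoSquares m) (hn : IsSumTwoSquares n) :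
    IsSumTwoSquares (m * n) := by
  obtain ⟨x, y, hm⟩ := hm
  obtain ⟨u, v, hn⟩ := hn
  refine ⟨x * u - y * v, x * v + y * u, ?_⟩
  push_cast
  rw [hm, hn]; ring

theorem isSumTwoSquares_one : IsSumTwoSquares 1 := ⟨1, 0, by norm_num⟩

theorem IsSumTwoSquares.pow {m : ℕ} (hm : IsSumTwoSquares m) (k : ℕ) :
    IsSumTwoSquares (m ^ k) := by
  induction k with
  | zero => simpa using isSumTwoSquares_one
  | succ k ih => rw [pow_succ]; exact ih.mul hm

theorem isSumTwoSquares_of_weight_ne_zero {d : ℕ} (hd : weight d ≠ 0) : IsSumTwoSquares d := by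
  have h1 : IsPrimePow d := by
    rw [← ArithmeticFunction.vonMangoldt_ne_zero_iff]
    exact left_ne_zero_of_mul hd
  have h2 : chi d ≠ -1 := by
    intro h
    apply hd
    rw [weight, h]; simp
  obtain ⟨p, k, hp, hk, rfl⟩ := h1
  have hp' : p.Prime := hp.nat_prime
  have := Fact.mk hp'
  by_cases h3 : p % 4 = 3
  · rcases Nat.even_or_odd' k with ⟨j, rfl | rfl⟩
    · exact ⟨(p : ℤ) ^ j, 0, by push_cast; ring⟩
    · exfalso
      apply h2
      have hp1 : chi p = -1 := by
        rw [chi_eq_ite, if_neg (by omega), if_neg (by omega)]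
      have hpow : ∀ i : ℕ, chi (p ^ (2 * i + 1)) = -1 := by
        intro i
        induction i with
        | zero => simpa using hp1
        | succ i ih =>
          rw [show p ^ (2 * (i + 1) + 1) = p ^ (2 * i + 1) * p * p by ring, chi_mul, chi_mul, ih,
            hp1]
          norm_num
      exact hpow j
  · refine IsSumTwoSquares.pow ?_ k
    obtain ⟨a, b, h⟩ := Nat.Prime.sq_add_sq h3
    exact (isSumTwoSquares_iff p).2 ⟨a, b, h.symm⟩

theorem b_mul_weight_le (m d : ℕ) : (b m : ℝ) * weight d ≤ b (d * m) * weight d := by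
  by_cases hd : weight d = 0
  · simp [hd]
  refine mul_le_mul_of_nonneg_right ?_ (weight_nonneg d)
  have h := isSumTwoSquares_of_weight_ne_zero hd
  rw [b, b]
  split_ifs with h1 h2
  · exact le_rfl
  · exact absurd (h.mul h1) h2
  · simp
  · simp

theorem sum_b_mul_weight_le_log (n : ℕ) :
    ∑ d ∈ n.divisors, (b (n / d) : ℝ) * weight d ≤ b n * Real.log n := by
  rw [← ArithmeticFunction.vonMangoldt_sum, Finset.mul_sum]
  refine Finset.sum_le_sum fun d hd => ?_
  have hd' := (Nat.mem_divisors.1 hd).1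
  refine (b_mul_weight_le _ _).trans ?_
  rw [Nat.mul_div_cancel' hd']
  exact mul_le_mul_of_nonneg_left (weight_le d) (by positivity)

/-- Logarithmically weighted counting function of the sums of two squares. -/
noncomputable def bLogSum (N : ℕ) : ℝ := ∑ n ∈ Icc 1 N, (b n : ℝ) / n

theorem sum_sum_divisors_eq' (f : ℕ → ℕ → ℝ) (N : ℕ) :
    ∑ n ∈ Icc 1 N, ∑ d ∈ n.divisors, f d (n / d) =
      ∑ m ∈ Icc 1 N, ∑ d ∈ Icc 1 (N / m), f d m := by
  rw [← sum_sum_divisors_eq (fun m d => f d m)]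
  refine Finset.sum_congr rfl fun n hn => ?_
  rw [← Nat.sum_div_divisors]
  refine Finset.sum_congr rfl fun d hd => ?_
  rw [Nat.div_div_self (Nat.mem_divisors.1 hd).1 (Nat.mem_divisors.1 hd).2]

theorem half_div_le_natDiv {N m : ℕ} (hm : 1 ≤ m) (h : m ≤ N) :
    (N : ℝ) / m / 2 ≤ ((N / m : ℕ) : ℝ) := by
  have hlt : (N : ℝ) / m < ((N / m : ℕ) : ℝ) + 1 := by
    rw [← Nat.floor_div_eq_div (K := ℝ)]
    exact Nat.lt_floor_add_one _
  have hk1' : (1 : ℝ) ≤ ((N / m : ℕ) : ℝ) := by exact_mod_cast Nat.div_pos h hm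
  linarith

theorem exists_bLogSum_mul_log_le :
    ∃ C : ℝ, 1 ≤ C ∧ ∀ N : ℕ, 1 ≤ N →
      bLogSum N * Real.log N ≤ 3 * ∑ n ∈ Icc 1 N, (b n : ℝ) / n * Real.log n + C * bLogSum N := by
  obtain ⟨C, hC, h⟩ := exists_abs_sum_weight_div_sub_log_le
  refine ⟨2 * C + 1, by linarith, fun N hN => ?_⟩
  have hN0 : (0 : ℝ) < N := by exact_mod_cast hN
  have h1 : ∑ m ∈ Icc 1 N, (b m : ℝ) / m * ∑ d ∈ Icc 1 (N / m), weight d / d ≤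
      ∑ n ∈ Icc 1 N, (b n : ℝ) / n * Real.log n := by
    simp only [Finset.mul_sum]
    rw [← sum_sum_divisors_eq' (fun d m => (b m : ℝ) / m * (weight d / d))]
    refine Finset.sum_le_sum fun n hn => ?_
    have hn1 := (mem_Icc.1 hn).1
    have hn0 : (0 : ℝ) < n := by exact_mod_cast hn1
    have := div_le_div_of_nonneg_right (sum_b_mul_weight_le_log n) hn0.le
    rw [Finset.sum_div] at this
    refine le_trans (le_of_eq ?_) (this.trans (le_of_eq (by ring)))
    refine Finset.sum_congr rfl fun d hd => ?_
    obtain ⟨m, rfl⟩ := (Nat.mem_divisors.1 hd).1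
    have hd0 : 0 < d := Nat.pos_of_ne_zero (by rintro rfl; simp at hn1)
    have hm0 : m ≠ 0 := by rintro rfl; simp at hn1
    rw [Nat.mul_div_cancel_left _ hd0]
    push_cast
    field_simp
  have h2 : ∑ m ∈ Icc 1 N, (b m : ℝ) / m * ((Real.log N - Real.log m - 1) / 2 - C) ≤
      ∑ n ∈ Icc 1 N, (b n : ℝ) / n * Real.log n := by
    refine le_trans (Finset.sum_le_sum fun m hm => ?_) h1
    have hm' := mem_Icc.1 hm
    have hm0 : (0 : ℝ) < m := by exact_mod_cast hm'.1
    refine mul_le_mul_of_nonneg_left ?_ (by positivity)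
    have a1 := abs_le.1 (h (N / m) (Nat.div_pos hm'.2 hm'.1))
    have a2 := Real.log_le_log (by positivity) (half_div_le_natDiv hm'.1 hm'.2)
    rw [Real.log_div (by positivity) (by norm_num), Real.log_div hN0.ne' hm0.ne'] at a2
    have a3 := Real.log_two_lt_d9
    linarith [a1.1]
  have h3 : ∑ m ∈ Icc 1 N, (b m : ℝ) / m * ((Real.log N - Real.log m - 1) / 2 - C) =
      bLogSum N * ((Real.log N - 1) / 2 - C) -
        (∑ n ∈ Icc 1 N, (b n : ℝ) / n * Real.log n) / 2 := by
    rw [bLogSum, Finset.sum_mul, Finset.sum_div, ← Finset.sum_sub_distrib]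
    exact Finset.sum_congr rfl fun m _ => by ring
  rw [h3] at h2
  linarith

/-- The integral of `bLogSum` against `dt / t`, as a sum over unit intervals. -/
noncomputable def bLogIntegral : ℕ → ℝ
  | 0 => 0
  | n + 1 => bLogIntegral n + bLogSum n * (Real.log (n + 1 : ℕ) - Real.log n)

theorem sum_b_div_mul_log_eq (N : ℕ) :
    ∑ n ∈ Icc 1 N, (b n : ℝ) / n * Real.log n = bLogSum N * Real.log N - bLogIntegral N := by
  induction N with
  | zero => simp [bLogIntegral]
  | succ N ih =>
    rw [Finset.sum_Icc_succ_top (by omega), ih, bLogIntegral]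
    have : bLogSum (N + 1) = bLogSum N + (b (N + 1) : ℝ) / (N + 1 : ℕ) := by
      rw [bLogSum, Finset.sum_Icc_succ_top (by omega)]; rfl
    rw [this]
    ring

theorem b_one : b 1 = 1 := if_pos isSumTwoSquares_one

theorem one_le_bLogSum {N : ℕ} (h : 1 ≤ N) : 1 ≤ bLogSum N := by
  have : ((b 1 : ℕ) : ℝ) / (1 : ℕ) ≤ bLogSum N :=
    Finset.single_le_sum (f := fun n : ℕ => (b n : ℝ) / n) (fun i _ => by positivity)
      (mem_Icc.2 ⟨le_rfl, h⟩)
  simpa [b_one] using this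

theorem exists_sqrt_log_le_bLogSum :
    ∃ c : ℝ, 0 < c ∧ ∀ N : ℕ, 2 ≤ N → c * √(Real.log N) ≤ bLogSum N := by
  obtain ⟨C, hC, h⟩ := exists_bLogSum_mul_log_le
  have hU : ∀ N : ℕ, 1 ≤ N → 3 / 2 * bLogIntegral N ≤ bLogSum N * (Real.log N + C) := by
    intro N hN
    have h1 := h N hN
    rw [sum_b_div_mul_log_eq] at h1
    have h2 : 0 ≤ C * bLogSum N := by have := one_le_bLogSum hN; positivity
    nlinarith
  have hlog : ∀ N : ℕ, 0 ≤ Real.log N := fun N => Real.log_natCast_nonneg N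
  have hpos : ∀ N : ℕ, 2 ≤ N → 0 < bLogIntegral N := by
    intro N hN
    induction N, hN using Nat.le_induction with
    | base =>
      have : bLogSum 1 = 1 := by simp [bLogSum, b_one]
      simp only [bLogIntegral, this]
      simpa using Real.log_pos one_lt_two
    | succ N hN ih =>
      rw [bLogIntegral]
      have h1 := one_le_bLogSum (show 1 ≤ N by omega)
      have h2 : Real.log N ≤ Real.log (N + 1 : ℕ) :=
        Real.log_le_log (by positivity) (by push_cast; linarith)
      nlinarith
  set A : ℕ → ℝ := fun N => Real.log (bLogIntegral N) - 3 / 2 * Real.log (Real.log N + C) -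
    9 / 4 / N with hA
  have hmono : ∀ N : ℕ, 2 ≤ N → A 2 ≤ A N := by
    intro N hN
    induction N, hN using Nat.le_induction with
    | base => exact le_rfl
    | succ N hN ih =>
      refine ih.trans ?_
      have hN0 : (0 : ℝ) < N := by positivity
      have hN2 : (2 : ℝ) ≤ N := by exact_mod_cast hN
      have hL : 1 ≤ Real.log N + C := by linarith [hlog N]
      set L := Real.log N + C with hLdef
      set ℓ := Real.log (N + 1 : ℕ) - Real.log N with hℓ
      have hℓ0 : 0 ≤ ℓ := sub_nonneg.2 (Real.log_le_log hN0 (by push_cast; linarith))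
      have hℓ1 : ℓ ≤ 1 / N := by
        rw [hℓ, ← Real.log_div (by positivity) hN0.ne']
        refine (Real.log_le_sub_one_of_pos (by positivity)).trans (le_of_eq ?_)
        push_cast; field_simp; ring
      set t := ℓ / L with ht
      have ht0 : 0 ≤ t := by positivity
      have ht1 : t ≤ 1 / N := (div_le_self hℓ0 hL).trans hℓ1
      have hUN := hpos N hN
      have e1 : bLogIntegral N * (1 + 3 / 2 * t) ≤ bLogIntegral (N + 1) := by
        rw [bLogIntegral]
        have : 3 / 2 * bLogIntegral N * t ≤ bLogSum N * ℓ := by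
          calc 3 / 2 * bLogIntegral N * t ≤ bLogSum N * L * t :=
                mul_le_mul_of_nonneg_right (hU N (by omega)) ht0
            _ = bLogSum N * ℓ := by rw [ht]; field_simp
        rw [← hℓ]
        linarith
      have e2 : Real.log (bLogIntegral N) + Real.log (1 + 3 / 2 * t) ≤
          Real.log (bLogIntegral (N + 1)) := by
        rw [← Real.log_mul hUN.ne' (by positivity)]
        exact Real.log_le_log (by positivity) e1
      have e3 : 3 / 2 * t - 9 / 8 * t ^ 2 ≤ Real.log (1 + 3 / 2 * t) := by
        refine le_trans ?_ (Real.le_log_one_add_of_nonneg (by positivity))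
        rw [le_div_iff₀ (by positivity)]
        have : 0 ≤ t ^ 3 := by positivity
        nlinarith
      have e4 : Real.log (Real.log (N + 1 : ℕ) + C) ≤ Real.log L + t := by
        have : Real.log (N + 1 : ℕ) + C = L * (1 + t) := by
          rw [ht]; field_simp; rw [hℓ, hLdef]; ring
        rw [this, Real.log_mul (by positivity) (by positivity)]
        have := Real.log_le_sub_one_of_pos (show 0 < 1 + t by positivity)
        linarith
      have e5 : 9 / 8 * t ^ 2 ≤ 9 / 4 / N - 9 / 4 / (N + 1 : ℕ) := by
        have : t ^ 2 ≤ (1 / N) ^ 2 := pow_le_pow_left₀ ht0 ht1 2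
        have h2 : (9 / 4 / N - 9 / 4 / (N + 1 : ℕ) : ℝ) = 9 / 4 / (N * (N + 1)) := by
          push_cast; field_simp; ring
        rw [h2]
        refine (mul_le_mul_of_nonneg_left this (by norm_num)).trans ?_
        rw [one_div, inv_pow, ← div_eq_mul_inv, div_le_div_iff₀ (by positivity) (by positivity)]
        nlinarith
      simp only [hA]
      linarith
  refine ⟨3 / 2 * Real.exp (A 2), by positivity, fun N hN => ?_⟩
  have hL : 1 ≤ Real.log N + C := by linarith [hlog N]
  have hL0 : 0 < Real.log N + C := by linarith
  have h1 : A 2 + 3 / 2 * Real.log (Real.log N + C) ≤ Real.log (bLogIntegral N) := by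
    have := hmono N hN
    have h2 : (0 : ℝ) ≤ 9 / 4 / N := by positivity
    simp only [hA] at this ⊢
    linarith
  have h2 : Real.exp (A 2) * ((Real.log N + C) * √(Real.log N + C)) ≤ bLogIntegral N := by
    rw [Real.le_log_iff_exp_le (hpos N hN), Real.exp_add] at h1
    refine le_trans (le_of_eq ?_) h1
    congr 1
    rw [mul_comm (3 / 2 : ℝ), ← Real.rpow_def_of_pos hL0,
      show (3 / 2 : ℝ) = 1 + 1 / 2 by norm_num, Real.rpow_add hL0, Real.rpow_one,
      Real.sqrt_eq_rpow]
  have h3 : 3 / 2 * Real.exp (A 2) * √(Real.log N + C) ≤ bLogSum N := by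
    have := hU N (by omega)
    refine le_of_mul_le_mul_right ?_ hL0
    linarith
  refine le_trans ?_ h3
  gcongr
  linarith

/-- The number of sums of two squares up to `N` is `≫ N / √(log N)`. -/
theorem exists_le_sum_b :
    ∃ c : ℝ, 0 < c ∧ ∃ N₀ : ℕ, 2 ≤ N₀ ∧ ∀ N : ℕ, N₀ ≤ N →
      c * N / √(Real.log N) ≤ ∑ n ∈ Icc 1 N, (b n : ℝ) := by
  obtain ⟨c₁, hc₁, D, hD, h₁⟩ := exists_le_sum_weight
  obtain ⟨c₂, hc₂, h₂⟩ := exists_sqrt_log_le_bLogSum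
  refine ⟨c₁ * c₂ / 4, by positivity, 16 * D ^ 2, by nlinarith, fun N hN => ?_⟩
  have hDN : 4 * D ≤ N := by nlinarith
  have hD0 : (0 : ℝ) < D := by exact_mod_cast hD
  have hN1 : 4 ≤ N := by omega
  have hN0 : (0 : ℝ) < N := by positivity
  have hlogN : 0 < Real.log N := Real.log_pos (by exact_mod_cast (by omega : 1 < N))
  have h3 : ∑ m ∈ Icc 1 N, (b m : ℝ) * ∑ d ∈ Icc 1 (N / m), weight d ≤
      (∑ n ∈ Icc 1 N, (b n : ℝ)) * Real.log N := by
    simp only [Finset.mul_sum, Finset.sum_mul]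
    rw [← sum_sum_divisors_eq' (fun d m => (b m : ℝ) * weight d)]
    refine Finset.sum_le_sum fun n hn => ?_
    have hn' := mem_Icc.1 hn
    refine (sum_b_mul_weight_le_log n).trans ?_
    refine mul_le_mul_of_nonneg_left ?_ (by positivity)
    exact Real.log_le_log (by exact_mod_cast hn'.1) (by exact_mod_cast hn'.2)
  have h4 : c₁ * N / 2 * bLogSum (N / D) ≤
      ∑ m ∈ Icc 1 N, (b m : ℝ) * ∑ d ∈ Icc 1 (N / m), weight d := by
    have hsub : Icc 1 (N / D) ⊆ Icc 1 N := Finset.Icc_subset_Icc_right (Nat.div_le_self _ _)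
    refine le_trans ?_ (Finset.sum_le_sum_of_subset_of_nonneg hsub fun m _ _ =>
      mul_nonneg (by positivity) (Finset.sum_nonneg fun _ _ => weight_nonneg _))
    rw [bLogSum, Finset.mul_sum]
    refine Finset.sum_le_sum fun m hm => ?_
    have hm' := mem_Icc.1 hm
    have hm0 : (0 : ℝ) < m := by exact_mod_cast hm'.1
    have hmD : m * D ≤ N := (Nat.le_div_iff_mul_le hD).1 hm'.2
    have a1 := h₁ (N / m) ((Nat.le_div_iff_mul_le hm'.1).2 (by linarith))
    have a2 := half_div_le_natDiv hm'.1 ((hm'.2).trans (Nat.div_le_self _ _))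
    calc c₁ * N / 2 * (b m / m) = b m * (c₁ * (N / m / 2)) := by ring
      _ ≤ b m * ∑ d ∈ Icc 1 (N / m), weight d := by
        refine mul_le_mul_of_nonneg_left (le_trans ?_ a1) (by positivity)
        exact mul_le_mul_of_nonneg_left a2 hc₁.le
  have h5 : c₂ * (√(Real.log N) / 2) ≤ bLogSum (N / D) := by
    refine le_trans ?_ (h₂ (N / D) ((Nat.le_div_iff_mul_le hD).2 (by omega)))
    refine mul_le_mul_of_nonneg_left ?_ hc₂.le
    have hDle : D ≤ N := by omega
    have e1 : √(N : ℝ) ≤ ((N / D : ℕ) : ℝ) := by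
      refine le_trans ?_ (half_div_le_natDiv hD hDle)
      have e2 : (16 * D ^ 2 : ℝ) ≤ N := by exact_mod_cast hN
      have e3 : 4 * (D : ℝ) ≤ √(N : ℝ) := Real.le_sqrt_of_sq_le (by nlinarith)
      rw [div_div, le_div_iff₀ (by positivity)]
      nlinarith [Real.mul_self_sqrt hN0.le, Real.sqrt_nonneg (N : ℝ)]
    have e2 : Real.log N / 2 ≤ Real.log ((N / D : ℕ) : ℝ) := by
      rw [← Real.log_sqrt hN0.le]
      exact Real.log_le_log (by positivity) e1
    refine Real.le_sqrt_of_sq_le ?_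
    rw [div_pow, Real.sq_sqrt hlogN.le]
    linarith
  have h6 : c₁ * c₂ / 4 * N * √(Real.log N) ≤ (∑ n ∈ Icc 1 N, (b n : ℝ)) * Real.log N := by
    refine le_trans ?_ (h4.trans h3)
    calc c₁ * c₂ / 4 * N * √(Real.log N) = c₁ * N / 2 * (c₂ * (√(Real.log N) / 2)) := by ring
      _ ≤ _ := mul_le_mul_of_nonneg_left h5 (by positivity)
  have hs : 0 < √(Real.log N) := Real.sqrt_pos.2 hlogN
  rw [div_le_iff₀ hs]
  refine le_of_mul_le_mul_right ?_ hs
  rw [mul_assoc _ (√(Real.log N)), Real.mul_self_sqrt hlogN.le]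
  exact h6

/-- A second moment bound: among the residue classes modulo `n`, the mass of `f` on `[1, M]`
produces many pairs that differ by a multiple of `n`. -/
theorem sq_sum_le_mul_sum_shift (f : ℕ → ℝ) (hf0 : ∀ m, 0 ≤ f m) (hf1 : ∀ m, f m ≤ 1)
    {n M K : ℕ} (hn : 0 < n) (hK : M / n ≤ K) :
    (∑ m ∈ Icc 1 M, f m) ^ 2 ≤
      n * (2 * ∑ k ∈ Icc 1 K, ∑ m ∈ Icc 1 M, f m * f (m + n * k) + ∑ m ∈ Icc 1 M, f m) := by
  set I := Icc 1 M
  have h1 : ∑ r ∈ range n, ∑ m ∈ I with m % n = r, f m = ∑ m ∈ I, f m :=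
    Finset.sum_fiberwise_of_maps_to (fun m _ => mem_range.2 (Nat.mod_lt m hn)) f
  have h2 : (∑ m ∈ I, f m) ^ 2 ≤ n * ∑ r ∈ range n, (∑ m ∈ I with m % n = r, f m) ^ 2 := by
    rw [← h1]
    simpa using sq_sum_le_card_mul_sum_sq (s := range n) (f := fun r => ∑ m ∈ I with m % n = r, f m)
  have h3 : ∑ r ∈ range n, (∑ m ∈ I with m % n = r, f m) ^ 2 =
      ∑ m ∈ I, ∑ m' ∈ I, if m % n = m' % n then f m * f m' else 0 := by
    rw [← Finset.sum_fiberwise_of_maps_to (s := I) (t := range n) (g := fun m => m % n)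
      (fun m _ => mem_range.2 (Nat.mod_lt m hn))]
    refine Finset.sum_congr rfl fun r _ => ?_
    rw [sq, Finset.sum_mul_sum]
    refine Finset.sum_congr rfl fun m hm => ?_
    rw [Finset.sum_filter]
    refine Finset.sum_congr rfl fun m' _ => ?_
    rw [(mem_filter.1 hm).2]
    exact if_congr eq_comm rfl rfl
  set g : ℕ → ℕ → ℝ := fun m m' => if m < m' ∧ m % n = m' % n then f m * f m' else 0 with hg
  have h4 : ∑ m ∈ I, ∑ m' ∈ I, (if m % n = m' % n then f m * f m' else 0) ≤
      ∑ m ∈ I, ∑ m' ∈ I, g m m' + ∑ m ∈ I, ∑ m' ∈ I, g m' m + ∑ m ∈ I, f m := by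
    rw [← Finset.sum_add_distrib, ← Finset.sum_add_distrib]
    refine Finset.sum_le_sum fun m hm => ?_
    have e : f m = ∑ m' ∈ I, if m = m' then f m else 0 := by
      rw [Finset.sum_ite_eq, if_pos hm]
    conv_rhs => rw [e]
    rw [← Finset.sum_add_distrib, ← Finset.sum_add_distrib]
    refine Finset.sum_le_sum fun m' _ => ?_
    simp only [hg]
    rcases lt_trichotomy m m' with h | h | h
    · rw [if_neg h.ne]
      simp [h, h.not_gt]
    · subst h
      simp only [lt_irrefl, false_and, if_false, if_true, zero_add]
      exact mul_le_of_le_one_right (hf0 m) (hf1 m)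
    · rw [if_neg h.ne']
      simp [h, h.not_gt, mul_comm, eq_comm]
  have h5 : ∑ m ∈ I, ∑ m' ∈ I, g m' m = ∑ m ∈ I, ∑ m' ∈ I, g m m' := Finset.sum_comm
  have h6 : ∑ m ∈ I, ∑ m' ∈ I, g m m' ≤ ∑ k ∈ Icc 1 K, ∑ m ∈ I, f m * f (m + n * k) := by
    rw [Finset.sum_comm (s := Icc 1 K)]
    refine Finset.sum_le_sum fun m hm => ?_
    simp only [hg]
    rw [← Finset.sum_filter]
    have hinj : Set.InjOn (fun k => m + n * k) (Icc 1 K : Finset ℕ) := by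
      intro k _ k' _ h
      exact Nat.eq_of_mul_eq_mul_left hn (Nat.add_left_cancel h)
    rw [← Finset.sum_image (f := fun m' => f m * f m') hinj]
    refine Finset.sum_le_sum_of_subset_of_nonneg ?_ fun _ _ _ => mul_nonneg (hf0 _) (hf0 _)
    intro m' hm'
    obtain ⟨hm'I, hlt, hmod⟩ := mem_filter.1 hm'
    have hM := (mem_Icc.1 hm'I).2
    obtain ⟨k, hk⟩ := (Nat.modEq_iff_dvd' hlt.le).1 hmod
    refine mem_image.2 ⟨k, mem_Icc.2 ⟨?_, ?_⟩, by omega⟩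
    · rcases Nat.eq_zero_or_pos k with rfl | h
      · simp at hk; omega
      · exact h
    · refine le_trans ?_ hK
      rw [Nat.le_div_iff_mul_le hn, mul_comm]
      omega
  have hn0 : (0 : ℝ) ≤ n := by positivity
  refine h2.trans (mul_le_mul_of_nonneg_left ?_ hn0)
  rw [h3]
  linarith

theorem b_le_one (m : ℕ) : (b m : ℝ) ≤ 1 := by
  rw [b]; split_ifs <;> simp

/-- The lower bound `G n ≫ n (log n)^{1/4}`. -/
theorem exists_le_G :
    ∃ c : ℝ, 0 < c ∧ ∃ N₀ : ℕ, ∀ n : ℕ, N₀ ≤ n →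
      c * n * Real.log n ^ ((1 : ℝ) / 4) ≤ (G n : ℝ) := by
  obtain ⟨c, hc, N₁, -, h⟩ := exists_le_sum_b
  set c' := c / 4 with hc'
  have hc'0 : 0 < c' := by positivity
  have htop : Tendsto (fun n : ℕ => Real.log n ^ ((1 : ℝ) / 8)) atTop atTop :=
    (tendsto_rpow_atTop (by norm_num)).comp (Real.tendsto_log_atTop.comp tendsto_natCast_atTop_atTop)
  obtain ⟨N₂, hN₂⟩ := eventually_atTop.1 (htop.eventually_ge_atTop (2 / c'))
  refine ⟨c' ^ 2 / 4, by positivity, max N₂ (max N₁ 3), fun n hn => ?_⟩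
  have hn2 : N₂ ≤ n := (le_max_left _ _).trans hn
  have hn1 : N₁ ≤ n := (le_max_left _ _).trans ((le_max_right _ _).trans hn)
  have hn3 : 3 ≤ n := (le_max_right _ _).trans ((le_max_right _ _).trans hn)
  have hn3' : (3 : ℝ) ≤ n := by exact_mod_cast hn3
  have hn0 : (0 : ℝ) < n := by positivity
  set l := Real.log n with hl
  have hl1 : 1 ≤ l := by
    rw [hl, Real.le_log_iff_exp_le hn0]
    linarith [Real.exp_one_lt_d9]
  have hl0 : 0 < l := by linarith
  set κ := l ^ ((5 : ℝ) / 8) with hκ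
  have hκ1 : 1 ≤ κ := Real.one_le_rpow hl1 (by norm_num)
  have hκn : κ ≤ n := by
    calc κ ≤ l ^ (1 : ℝ) := Real.rpow_le_rpow_of_exponent_le hl1 (by norm_num)
      _ = l := Real.rpow_one l
      _ ≤ n := by rw [hl]; exact (Real.log_le_sub_one_of_pos hn0).trans (by linarith)
  set M := ⌊(n : ℝ) * κ⌋₊ with hM
  have hnκ : (n : ℝ) ≤ n * κ := le_mul_of_one_le_right hn0.le hκ1
  have hMle : (M : ℝ) ≤ n * κ := Nat.floor_le (by positivity)
  have hMlt : n * κ < M + 1 := Nat.lt_floor_add_one _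
  have hnM : n ≤ M := Nat.le_floor hnκ
  have hM0 : (0 : ℝ) < M := by exact_mod_cast (by omega : 0 < M)
  have hMge : n * κ / 2 ≤ M := by linarith
  have hlogM0 : 0 < Real.log M := Real.log_pos (by exact_mod_cast (by omega : 1 < M))
  have hlogM : Real.log M ≤ 4 * l := by
    have : (M : ℝ) ≤ (n : ℝ) ^ 2 := hMle.trans (by nlinarith)
    have := Real.log_le_log hM0 this
    rw [Real.log_pow] at this
    push_cast at this
    linarith
  set B := ∑ m ∈ Icc 1 M, (b m : ℝ) with hB
  have hBge : c' * n * l ^ ((1 : ℝ) / 8) ≤ B := by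
    refine le_trans ?_ (h M (hn1.trans hnM))
    rw [le_div_iff₀ (Real.sqrt_pos.2 hlogM0)]
    have h1 : √(Real.log M) ≤ 2 * l ^ ((1 : ℝ) / 2) := by
      rw [← Real.sqrt_eq_rpow]
      refine (Real.sqrt_le_sqrt hlogM).trans (le_of_eq ?_)
      rw [Real.sqrt_mul (by norm_num), show (4 : ℝ) = 2 ^ 2 by norm_num,
        Real.sqrt_sq (by norm_num)]
    have h2 : κ = l ^ ((1 : ℝ) / 8) * l ^ ((1 : ℝ) / 2) := by
      rw [← Real.rpow_add hl0]; norm_num [hκ]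
    calc c' * n * l ^ ((1 : ℝ) / 8) * √(Real.log M)
        ≤ c' * n * l ^ ((1 : ℝ) / 8) * (2 * l ^ ((1 : ℝ) / 2)) :=
          mul_le_mul_of_nonneg_left h1 (by positivity)
      _ = c * (n * κ / 2) := by rw [h2, hc']; ring
      _ ≤ c * M := mul_le_mul_of_nonneg_left hMge hc.le
  have hl8 : 2 ≤ c' * l ^ ((1 : ℝ) / 8) := by
    have := hN₂ n hn2
    rwa [div_le_iff₀' hc'0] at this
  have hB2 : 2 * n ≤ B := by nlinarith
  have hG : B ^ 2 ≤ n * (2 * (G n : ℝ) + B) := by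
    have hK : M / n ≤ ⌊κ⌋₊ := by
      refine Nat.le_floor ((Nat.cast_div_le (α := ℝ)).trans ?_)
      rw [div_le_iff₀ hn0]; linarith
    have := sq_sum_le_mul_sum_shift (fun m => (b m : ℝ)) (fun m => by positivity) b_le_one
      (show 0 < n by omega) hK
    rw [G]
    push_cast
    exact this
  have hsq : (c' * n * l ^ ((1 : ℝ) / 8)) ^ 2 ≤ B ^ 2 := pow_le_pow_left₀ (by positivity) hBge 2
  have hl4 : (l ^ ((1 : ℝ) / 8)) ^ 2 = l ^ ((1 : ℝ) / 4) := by
    rw [← Real.rpow_natCast, ← Real.rpow_mul hl0.le]; norm_num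
  rw [mul_pow, hl4] at hsq
  have hB4 : B ^ 2 ≤ 4 * n * (G n : ℝ) := by nlinarith
  refine le_of_mul_le_mul_left ?_ hn0
  nlinarith

/-- The Chung–Erdős inequality. -/
theorem sq_sum_measureReal_le {α ι : Type*} [MeasurableSpace α] (μ : Measure α) (J : Finset ι)
    (E : ι → Set α) (hE : ∀ j ∈ J, MeasurableSet (E j)) (hfin : ∀ j ∈ J, μ (E j) ≠ ⊤) :
    (∑ j ∈ J, μ.real (E j)) ^ 2 ≤
      μ.real (⋃ j ∈ J, E j) * ∑ i ∈ J, ∑ j ∈ J, μ.real (E i ∩ E j) := by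
  set U := ⋃ j ∈ J, E j with hU
  have hUm : MeasurableSet U := Finset.measurableSet_biUnion J hE
  have hUf : μ U ≠ ⊤ := (measure_biUnion_lt_top J.finite_toSet fun j hj => (hfin j hj).lt_top).ne
  set f : α → ℝ := fun x => ∑ j ∈ J, (E j).indicator 1 x with hf
  have hind : ∀ s : Set α, MeasurableSet s → μ s ≠ ⊤ → Integrable (s.indicator (1 : α → ℝ)) μ :=
    fun s hs hs' => (integrable_indicator_iff hs).2 (integrableOn_const hs')
  have hfi : Integrable f μ := integrable_finsetSum _ fun j hj => hind _ (hE j hj) (hfin j hj)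
  have hf1 : ∫ x, f x ∂μ = ∑ j ∈ J, μ.real (E j) := by
    rw [integral_finsetSum _ fun j hj => hind _ (hE j hj) (hfin j hj)]
    exact Finset.sum_congr rfl fun j hj => integral_indicator_one (hE j hj)
  have hsq : ∀ x, f x ^ 2 = ∑ i ∈ J, ∑ j ∈ J, (E i ∩ E j).indicator 1 x := by
    intro x
    rw [hf, sq, Finset.sum_mul_sum]
    refine Finset.sum_congr rfl fun i _ => Finset.sum_congr rfl fun j _ => ?_
    rw [Set.inter_indicator_one]; rfl
  have hint : ∀ i ∈ J, ∀ j ∈ J, Integrable ((E i ∩ E j).indicator (1 : α → ℝ)) μ :=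
    fun i hi j hj => hind _ ((hE i hi).inter (hE j hj))
      (measure_ne_top_of_subset Set.inter_subset_left (hfin i hi))
  have hf2i : Integrable (fun x => f x ^ 2) μ := by
    simp only [hsq]
    exact integrable_finsetSum _ fun i hi => integrable_finsetSum _ fun j hj => hint i hi j hj
  have hf2 : ∫ x, f x ^ 2 ∂μ = ∑ i ∈ J, ∑ j ∈ J, μ.real (E i ∩ E j) := by
    simp only [hsq]
    rw [integral_finsetSum _ fun i hi => integrable_finsetSum _ fun j hj => hint i hi j hj]
    refine Finset.sum_congr rfl fun i hi => ?_
    rw [integral_finsetSum _ fun j hj => hint i hi j hj]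
    exact Finset.sum_congr rfl fun j hj => integral_indicator_one ((hE i hi).inter (hE j hj))
  have hquad : ∀ z : ℝ, 0 ≤ μ.real U * (z * z) + (-2 * ∑ j ∈ J, μ.real (E j)) * z +
      ∑ i ∈ J, ∑ j ∈ J, μ.real (E i ∩ E j) := by
    intro z
    have h1 : 0 ≤ ∫ x, (z * U.indicator 1 x - f x) ^ 2 ∂μ := integral_nonneg fun x => sq_nonneg _
    have h2 : ∀ x, (z * U.indicator 1 x - f x) ^ 2 =
        z * z * U.indicator 1 x - 2 * z * f x + f x ^ 2 := by
      intro x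
      by_cases hx : x ∈ U
      · simp only [Set.indicator_of_mem hx, Pi.one_apply]; ring
      · have : f x = 0 := Finset.sum_eq_zero fun j hj =>
          Set.indicator_of_notMem (fun h => hx (Set.mem_biUnion hj h)) _
        simp [Set.indicator_of_notMem hx, this]
    simp only [h2] at h1
    have i1 : Integrable (fun x => z * z * U.indicator 1 x) μ := (hind U hUm hUf).const_mul _
    have i2 : Integrable (fun x => 2 * z * f x) μ := hfi.const_mul _
    have i3 : Integrable (fun x => z * z * U.indicator 1 x - 2 * z * f x) μ := i1.sub i2
    rw [integral_add i3 hf2i, integral_sub i1 i2, integral_const_mul,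
      integral_const_mul, integral_indicator_one hUm, hf1, hf2] at h1
    linarith
  have := discrim_le_zero hquad
  rw [discrim] at this
  nlinarith

/-- Points separated by at least `1 / R` meet an interval of length `2ρ` in at most `2ρR + 2`
points. -/
theorem card_filter_abs_sub_lt_le {ι : Type*} (P : Finset ι) (v : ι → ℝ) {R ρ : ℝ} (hR : 0 < R)
    (hρ : 0 ≤ ρ) (hsep : ∀ y ∈ P, ∀ y' ∈ P, y ≠ y' → 1 ≤ R * |v y - v y'|) (x : ℝ) :
    (((P.filter fun y => |x - v y| < ρ).card : ℕ) : ℝ) ≤ 2 * ρ * R + 2 := by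
  have h1 : (P.filter fun y => |x - v y| < ρ).card ≤
      (Icc ⌊(x - ρ) * R⌋ ⌊(x + ρ) * R⌋).card := by
    refine Finset.card_le_card_of_injOn (fun y => ⌊v y * R⌋) ?_ ?_
    · intro y hy
      have hy' := abs_lt.1 (mem_filter.1 hy).2
      refine mem_coe.2 (mem_Icc.2 ⟨Int.floor_le_floor ?_, Int.floor_le_floor ?_⟩) <;>
      · refine mul_le_mul_of_nonneg_right ?_ hR.le
        linarith
    · intro y hy y' hy' h
      by_contra hne
      have h2 := Int.abs_sub_lt_one_of_floor_eq_floor h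
      rw [← sub_mul, abs_mul, abs_of_pos hR, mul_comm] at h2
      linarith [hsep y (mem_filter.1 hy).1 y' (mem_filter.1 hy').1 hne]
  have h3 : (((Icc ⌊(x - ρ) * R⌋ ⌊(x + ρ) * R⌋).card : ℕ) : ℝ) ≤ 2 * ρ * R + 2 := by
    have hle : ⌊(x - ρ) * R⌋ ≤ ⌊(x + ρ) * R⌋ := Int.floor_le_floor (by nlinarith)
    rw [Int.card_Icc]
    have : (((⌊(x + ρ) * R⌋ + 1 - ⌊(x - ρ) * R⌋).toNat : ℤ) : ℝ) =
        ⌊(x + ρ) * R⌋ + 1 - ⌊(x - ρ) * R⌋ := by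
      rw [Int.toNat_of_nonneg (by omega)]; push_cast; ring
    rw [Int.cast_natCast] at this
    rw [this]
    have a1 := Int.floor_le ((x + ρ) * R)
    have a2 := Int.lt_floor_add_one ((x - ρ) * R)
    nlinarith
  exact le_trans (by exact_mod_cast h1) h3

/-- Reduced fractions `p / q` in `(0, 1)`, as pairs `(p, q)`, with `4 ^ (t - 1) < q ≤ 4 ^ t`. -/
def fareyBlock (t : ℕ) : Finset (ℕ × ℕ) :=
  (Icc 1 (4 ^ t) ×ˢ Icc 1 (4 ^ t)).filter
    fun x => x.1 < x.2 ∧ x.1.Coprime x.2 ∧ 4 ^ t < 4 * x.2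

/-- The real number represented by a pair. -/
noncomputable def pairDiv (x : ℕ × ℕ) : ℝ := (x.1 : ℝ) / x.2

theorem mem_fareyBlock {t : ℕ} {x : ℕ × ℕ} : x ∈ fareyBlock t ↔
    1 ≤ x.1 ∧ x.1 < x.2 ∧ x.2 ≤ 4 ^ t ∧ 4 ^ t < 4 * x.2 ∧ x.1.Coprime x.2 := by
  simp only [fareyBlock, mem_filter, mem_product, mem_Icc]
  constructor
  · rintro ⟨⟨⟨h1, h2⟩, h3, h4⟩, h5, h6, h7⟩; exact ⟨h1, h5, h4, h7, h6⟩
  · rintro ⟨h1, h5, h4, h7, h6⟩; exact ⟨⟨⟨h1, by omega⟩, by omega, h4⟩, h5, h6, h7⟩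

theorem card_fareyBlock_le (t : ℕ) : ((fareyBlock t).card : ℝ) ≤ 16 ^ t := by
  have : (fareyBlock t).card ≤ 16 ^ t := by
    refine (Finset.card_filter_le _ _).trans (le_of_eq ?_)
    rw [Finset.card_product, Nat.card_Icc, Nat.add_sub_cancel, ← mul_pow]
    norm_num
  exact_mod_cast this

theorem one_le_mul_abs_pairDiv_sub {t : ℕ} {x y : ℕ × ℕ} (hx : x ∈ fareyBlock t)
    (hy : y ∈ fareyBlock t) (hxy : x ≠ y) : 1 ≤ 16 ^ t * |pairDiv x - pairDiv y| := by
  obtain ⟨a1, a2, a3, -, a5⟩ := mem_fareyBlock.1 hx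
  obtain ⟨b1, b2, b3, -, b5⟩ := mem_fareyBlock.1 hy
  obtain ⟨p, q⟩ := x
  obtain ⟨p', q'⟩ := y
  simp only at *
  have hq : (0 : ℝ) < q := by exact_mod_cast (by omega : 0 < q)
  have hq' : (0 : ℝ) < q' := by exact_mod_cast (by omega : 0 < q')
  have hne : (p : ℤ) * q' - q * p' ≠ 0 := by
    intro h
    have h' : p * q' = q * p' := by zify; linarith
    apply hxy
    have e1 : q ∣ q' := a5.symm.dvd_of_dvd_mul_left ⟨p', h'⟩
    have e2 : q' ∣ q := b5.symm.dvd_of_dvd_mul_right ⟨p, by rw [← h']; ring⟩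
    have e3 : q = q' := Nat.dvd_antisymm e1 e2
    subst e3
    have : p = p' := Nat.eq_of_mul_eq_mul_left (by omega : 0 < q) (by rw [← h']; ring)
    rw [this]
  have h1 : (1 : ℝ) ≤ |(p : ℝ) * q' - q * p'| := by
    have := Int.one_le_abs hne
    exact_mod_cast this
  rw [pairDiv, pairDiv, div_sub_div _ _ hq.ne' hq'.ne', abs_div, abs_of_pos (mul_pos hq hq')]
  have h2 : (q : ℝ) * q' ≤ 16 ^ t := by
    have : q * q' ≤ 4 ^ t * 4 ^ t := Nat.mul_le_mul a3 b3
    rw [← mul_pow] at this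
    exact_mod_cast this
  rw [mul_div_assoc', le_div_iff₀ (mul_pos hq hq')]
  nlinarith [pow_pos (show (0 : ℝ) < 16 by norm_num) t]

theorem sum_inv_sq_le {N : ℕ} (hN : 2 ≤ N) :
    ∑ l ∈ Icc 2 N, 1 / (l : ℝ) ^ 2 ≤ 3 / 4 - 1 / (N : ℝ) := by
  induction N, hN using Nat.le_induction with
  | base => norm_num
  | succ N hN ih =>
    rw [Finset.sum_Icc_succ_top (by omega)]
    have hN0 : (0 : ℝ) < N := by positivity
    have : 1 / ((N + 1 : ℕ) : ℝ) ^ 2 ≤ 1 / (N : ℝ) - 1 / ((N + 1 : ℕ) : ℝ) := by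
      have e : 1 / (N : ℝ) - 1 / ((N + 1 : ℕ) : ℝ) = 1 / (N * (N + 1)) := by
        push_cast; field_simp; ring
      rw [e]
      refine one_div_le_one_div_of_le (by positivity) ?_
      push_cast; nlinarith
    linarith

/-- At least a quarter of the pairs in `[1, Q]²` are coprime. -/
theorem sq_div_four_le_card_coprime {Q : ℕ} (hQ : 2 ≤ Q) :
    (Q : ℝ) ^ 2 / 4 ≤
      (((Icc 1 Q ×ˢ Icc 1 Q).filter fun x : ℕ × ℕ => x.1.Coprime x.2).card : ℝ) := by
  set S := Icc 1 Q ×ˢ Icc 1 Q with hS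
  have hcard : S.card = Q ^ 2 := by simp [hS, sq]
  have hQ0 : (0 : ℝ) < Q := by positivity
  have h1 := Finset.card_filter_add_card_filter_not (s := S) (fun x : ℕ × ℕ => x.1.Coprime x.2)
  have h2 : S.filter (fun x : ℕ × ℕ => ¬ x.1.Coprime x.2) ⊆
      (Icc 2 Q).biUnion fun l => (Icc 1 Q).filter (l ∣ ·) ×ˢ (Icc 1 Q).filter (l ∣ ·) := by
    rintro ⟨p, q⟩ h
    simp only [hS, mem_filter, mem_product, mem_biUnion, mem_Icc] at h ⊢
    obtain ⟨⟨⟨h1, h2⟩, h3, h4⟩, h5⟩ := h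
    have h6 : p.gcd q ∣ p := Nat.gcd_dvd_left p q
    have h7 : 0 < p.gcd q := Nat.gcd_pos_of_pos_left _ h1
    have h8 : p.gcd q ≠ 1 := h5
    exact ⟨p.gcd q, ⟨by omega, (Nat.le_of_dvd h1 h6).trans h2⟩, ⟨⟨h1, h2⟩, h6⟩, ⟨h3, h4⟩,
      Nat.gcd_dvd_right p q⟩
  have h3 : ((S.filter fun x : ℕ × ℕ => ¬ x.1.Coprime x.2).card : ℝ) ≤ 3 / 4 * Q ^ 2 := by
    have e1 := (Finset.card_le_card h2).trans Finset.card_biUnion_le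
    have e2 : ∀ l, ((Icc 1 Q).filter (l ∣ ·)).card = Q / l := by
      intro l
      rw [← Nat.Ioc_filter_dvd_card_eq_div]; rfl
    simp only [Finset.card_product, e2] at e1
    have e3 : ((∑ l ∈ Icc 2 Q, Q / l * (Q / l) : ℕ) : ℝ) ≤
        ∑ l ∈ Icc 2 Q, (Q : ℝ) ^ 2 * (1 / (l : ℝ) ^ 2) := by
      push_cast
      refine Finset.sum_le_sum fun l hl => ?_
      have : ((Q / l : ℕ) : ℝ) ≤ (Q : ℝ) / l := Nat.cast_div_le
      calc ((Q / l : ℕ) : ℝ) * ((Q / l : ℕ) : ℝ) ≤ (Q : ℝ) / l * ((Q : ℝ) / l) := by gcongr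
        _ = _ := by ring
    rw [← Finset.mul_sum] at e3
    have e4 := sum_inv_sq_le hQ
    have e5 : (0 : ℝ) ≤ 1 / Q := by positivity
    have e6 : (Q : ℝ) ^ 2 * ∑ l ∈ Icc 2 Q, 1 / (l : ℝ) ^ 2 ≤ Q ^ 2 * (3 / 4) :=
      mul_le_mul_of_nonneg_left (by linarith) (by positivity)
    have e7 : ((S.filter fun x : ℕ × ℕ => ¬ x.1.Coprime x.2).card : ℝ) ≤
        ((∑ l ∈ Icc 2 Q, Q / l * (Q / l) : ℕ) : ℝ) := by exact_mod_cast e1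
    linarith
  rw [hcard] at h1
  have h4 : (((S.filter fun x : ℕ × ℕ => x.1.Coprime x.2).card : ℕ) : ℝ) +
      ((S.filter fun x : ℕ × ℕ => ¬ x.1.Coprime x.2).card : ℝ) = (Q : ℝ) ^ 2 := by
    exact_mod_cast h1
  linarith

theorem le_card_fareyBlock {t : ℕ} (ht : 1 ≤ t) :
    (16 : ℝ) ^ t / 32 ≤ ((fareyBlock t).card : ℝ) := by
  obtain ⟨s, rfl⟩ : ∃ s, t = s + 1 := ⟨t - 1, by omega⟩
  set A := (Icc 1 (4 ^ (s + 1)) ×ˢ Icc 1 (4 ^ (s + 1))).filter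
    (fun x : ℕ × ℕ => x.1.Coprime x.2) with hA
  have hpow : 1 ≤ 4 ^ s := Nat.one_le_pow _ _ (by norm_num)
  have hsub : A ⊆ ((fareyBlock (s + 1) ∪ (Icc 1 (4 ^ s)).biUnion fun q => (range q) ×ˢ {q}) ∪
      (fareyBlock (s + 1) ∪ (Icc 1 (4 ^ s)).biUnion fun q => (range q) ×ˢ {q}).image Prod.swap) ∪
      {(1, 1)} := by
    have key : ∀ p q : ℕ, 1 ≤ p → p < q → q ≤ 4 ^ (s + 1) → p.Coprime q →
        (p, q) ∈ fareyBlock (s + 1) ∪ (Icc 1 (4 ^ s)).biUnion fun q => (range q) ×ˢ {q} := by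
      intro p q h1 h2 h3 h4
      rw [mem_union, mem_fareyBlock, mem_biUnion]
      rcases le_or_gt q (4 ^ s) with h | h
      · right
        exact ⟨q, mem_Icc.2 ⟨by omega, h⟩, by simp [h2]⟩
      · left
        refine ⟨h1, h2, h3, ?_, h4⟩
        rw [pow_succ]; simp only; omega
    rintro ⟨p, q⟩ h
    simp only [hA, mem_filter, mem_product, mem_Icc] at h
    obtain ⟨⟨⟨h1, h2⟩, h3, h4⟩, h5⟩ := h
    rw [mem_union, mem_union]
    rcases lt_trichotomy p q with h | h | h
    · exact Or.inl (Or.inl (key p q h1 h h4 h5))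
    · subst h
      have : p = 1 := by simpa using h5
      right; simp [this]
    · refine Or.inl (Or.inr (mem_image.2 ⟨(q, p), key q p h3 h h2 h5.symm, rfl⟩))
  have hc1 : 2 * ((Icc 1 (4 ^ s)).biUnion fun q => (range q) ×ˢ ({q} : Finset ℕ)).card ≤
      4 ^ s * (4 ^ s + 1) := by
    refine (Nat.mul_le_mul_left 2 Finset.card_biUnion_le).trans ?_
    simp only [Finset.card_product, Finset.card_range, Finset.card_singleton, mul_one]
    have e : ∀ n : ℕ, 2 * ∑ x ∈ Icc 1 n, x = n * (n + 1) := by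
      intro n
      induction n with
      | zero => simp
      | succ n ih => rw [Finset.sum_Icc_succ_top (by omega), mul_add, ih]; ring
    exact (e _).le
  have hc2 : A.card ≤ 2 * (fareyBlock (s + 1)).card + 4 ^ s * (4 ^ s + 1) + 1 := by
    have e1 := Finset.card_union_le (fareyBlock (s + 1))
      ((Icc 1 (4 ^ s)).biUnion fun q => (range q) ×ˢ ({q} : Finset ℕ))
    refine (Finset.card_le_card hsub).trans ((Finset.card_union_le _ _).trans ?_)
    rw [Finset.card_singleton]
    have e2 := Finset.card_union_le
      (fareyBlock (s + 1) ∪ (Icc 1 (4 ^ s)).biUnion fun q => (range q) ×ˢ {q})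
      ((fareyBlock (s + 1) ∪ (Icc 1 (4 ^ s)).biUnion fun q => (range q) ×ˢ {q}).image Prod.swap)
    have e3 : ((fareyBlock (s + 1) ∪ (Icc 1 (4 ^ s)).biUnion fun q =>
      (range q) ×ˢ {q}).image Prod.swap).card ≤ _ := Finset.card_image_le
    omega
  have hc3 := sq_div_four_le_card_coprime (Q := 4 ^ (s + 1)) (by rw [pow_succ]; omega)
  have hc4 : (A.card : ℝ) ≤ 2 * ((fareyBlock (s + 1)).card : ℝ) + 4 ^ s * (4 ^ s + 1) + 1 := by
    exact_mod_cast hc2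
  have hz : (1 : ℝ) ≤ 4 ^ s := by exact_mod_cast hpow
  have h16 : (16 : ℝ) ^ (s + 1) = 16 * (4 ^ s * 4 ^ s) := by
    rw [pow_succ, ← mul_pow]; norm_num; ring
  have h4 : ((4 ^ (s + 1) : ℕ) : ℝ) = 4 * 4 ^ s := by push_cast; ring
  rw [h4] at hc3
  rw [h16]
  change _ ≤ (A.card : ℝ) at hc3
  nlinarith

/-- The ball of radius `a t / 16 ^ t` around the fraction represented by `x`. -/
noncomputable def fareyBall (a : ℕ → ℝ) (t : ℕ) (x : ℕ × ℕ) : Set ℝ :=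
  Metric.ball (pairDiv x) (a t / 16 ^ t)

theorem measureReal_fareyBall {a : ℕ → ℝ} (ha : ∀ t, 0 ≤ a t) (t : ℕ) (x : ℕ × ℕ) :
    volume.real (fareyBall a t x) = 2 * (a t / 16 ^ t) := by
  rw [fareyBall, Real.volume_real_ball (div_nonneg (ha t) (by positivity))]

theorem sum_measureReal_inter_fareyBall_le {a : ℕ → ℝ} (ha : ∀ t, 0 ≤ a t) (ha1 : ∀ t, a t ≤ 1)
    {s t : ℕ} (hst : s ≤ t) :
    ∑ x ∈ fareyBlock s, ∑ y ∈ fareyBlock t, volume.real (fareyBall a s x ∩ fareyBall a t y) ≤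
      4 * a s * a t + 8 * a t * (1 / 16) ^ (t - s) := by
  set rs := a s / 16 ^ s with hrs
  set rt := a t / 16 ^ t with hrt
  have hrs0 : 0 ≤ rs := div_nonneg (ha s) (by positivity)
  have hrt0 : 0 ≤ rt := div_nonneg (ha t) (by positivity)
  have hinner : ∀ x, ∑ y ∈ fareyBlock t, volume.real (fareyBall a s x ∩ fareyBall a t y) ≤
      (2 * (rs + rt) * 16 ^ t + 2) * (2 * rt) := by
    intro x
    have h1 : ∀ y ∈ fareyBlock t, volume.real (fareyBall a s x ∩ fareyBall a t y) ≤
        if |pairDiv x - pairDiv y| < rs + rt then 2 * rt else 0 := by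
      intro y _
      split_ifs with h
      · rw [hrt, ← measureReal_fareyBall ha t y]
        exact measureReal_mono Set.inter_subset_right measure_ball_lt_top.ne
      · have : fareyBall a s x ∩ fareyBall a t y = ∅ := by
          refine Set.disjoint_iff_inter_eq_empty.1 (Metric.ball_disjoint_ball ?_)
          rw [Real.dist_eq]
          exact not_lt.1 h
        simp [this]
    refine (Finset.sum_le_sum h1).trans ?_
    rw [← Finset.sum_filter, Finset.sum_const, nsmul_eq_mul]
    refine mul_le_mul_of_nonneg_right ?_ (by positivity)
    exact card_filter_abs_sub_lt_le _ _ (by positivity) (by positivity)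
      (fun y hy y' hy' => one_le_mul_abs_pairDiv_sub hy hy') _
  refine (Finset.sum_le_sum fun x _ => hinner x).trans ?_
  rw [Finset.sum_const, nsmul_eq_mul]
  refine (mul_le_mul_of_nonneg_right (card_fareyBlock_le s) (by positivity)).trans ?_
  obtain ⟨d, rfl⟩ := Nat.exists_eq_add_of_le hst
  rw [Nat.add_sub_cancel_left, one_div_pow]
  have hat := ha (s + d)
  have hat1 := ha1 (s + d)
  have e : (16 : ℝ) ^ s * ((2 * (rs + rt) * 16 ^ (s + d) + 2) * (2 * rt)) =
      4 * a s * a (s + d) + (4 * a (s + d) * a (s + d) + 4 * a (s + d)) * (1 / 16 ^ d) := by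
    rw [hrs, hrt, pow_add]
    field_simp
    ring
  rw [e]
  gcongr
  nlinarith

theorem sum_ite_pow_sub_le (I : Finset ℕ) (t : ℕ) :
    ∑ s ∈ I, (if s ≤ t then (1 / 16 : ℝ) ^ (t - s) else 0) ≤ 2 := by
  rw [← Finset.sum_filter]
  have h1 : ∑ s ∈ I with s ≤ t, (1 / 16 : ℝ) ^ (t - s) ≤
      ∑ s ∈ range (t + 1), (1 / 16 : ℝ) ^ (t - s) := by
    refine Finset.sum_le_sum_of_subset_of_nonneg ?_ fun _ _ _ => by positivity
    intro s hs
    exact mem_range.2 (Nat.lt_succ_of_le (mem_filter.1 hs).2)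
  have h2 := Finset.sum_range_reflect (fun j => (1 / 16 : ℝ) ^ j) (t + 1)
  simp only [Nat.add_sub_cancel] at h2
  refine h1.trans ?_
  rw [h2, geom_sum_eq (by norm_num), ← neg_div_neg_eq, div_le_iff₀ (by norm_num)]
  have : (0 : ℝ) ≤ (1 / 16) ^ (t + 1) := by positivity
  linarith

theorem le_measureReal_biUnion_fareyBall {a : ℕ → ℝ} (ha : ∀ t, 0 ≤ a t) (ha1 : ∀ t, a t ≤ 1)
    {I : Finset ℕ} (hI : ∀ t ∈ I, 1 ≤ t) (hS : 1 ≤ ∑ t ∈ I, a t) :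
    1 / 9216 ≤ volume.real (⋃ j ∈ I.sigma fareyBlock, fareyBall a j.1 j.2) := by
  set S := ∑ t ∈ I, a t with hSdef
  have hmain := sq_sum_measureReal_le volume (I.sigma fareyBlock)
    (fun j => fareyBall a j.1 j.2) (fun _ _ => Metric.isOpen_ball.measurableSet)
    (fun _ _ => measure_ball_lt_top.ne)
  have h1 : S / 16 ≤ ∑ j ∈ I.sigma fareyBlock, volume.real (fareyBall a j.1 j.2) := by
    rw [Finset.sum_sigma, hSdef, Finset.sum_div]
    refine Finset.sum_le_sum fun t ht => ?_
    simp only [measureReal_fareyBall ha]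
    rw [Finset.sum_const, nsmul_eq_mul]
    have hc := le_card_fareyBlock (hI t ht)
    calc a t / 16 = 16 ^ t / 32 * (2 * (a t / 16 ^ t)) := by field_simp; ring
      _ ≤ _ := mul_le_mul_of_nonneg_right hc
        (mul_nonneg zero_le_two (div_nonneg (ha t) (by positivity)))
  have h2 : ∑ i ∈ I.sigma fareyBlock, ∑ j ∈ I.sigma fareyBlock,
      volume.real (fareyBall a i.1 i.2 ∩ fareyBall a j.1 j.2) ≤ 36 * S ^ 2 := by
    set w : ℕ → ℕ → ℝ := fun s t => if s ≤ t then (1 / 16 : ℝ) ^ (t - s) else 0 with hw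
    have hw0 : ∀ s t, 0 ≤ w s t := fun s t => by
      simp only [hw]; split_ifs <;> positivity
    have hpair : ∀ s t, ∑ x ∈ fareyBlock s, ∑ y ∈ fareyBlock t,
        volume.real (fareyBall a s x ∩ fareyBall a t y) ≤
        4 * a s * a t + 8 * a t * w s t + 8 * a s * w t s := by
      intro s t
      rcases le_total s t with h | h
      · have := sum_measureReal_inter_fareyBall_le ha ha1 h
        have e : w s t = (1 / 16 : ℝ) ^ (t - s) := if_pos h
        have := mul_nonneg (mul_nonneg (by norm_num : (0 : ℝ) ≤ 8) (ha s)) (hw0 t s)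
        rw [e]; linarith
      · have := sum_measureReal_inter_fareyBall_le ha ha1 h
        rw [Finset.sum_comm] at this
        simp only [Set.inter_comm (fareyBall a t _)] at this
        have e : w t s = (1 / 16 : ℝ) ^ (s - t) := if_pos h
        have := mul_nonneg (mul_nonneg (by norm_num : (0 : ℝ) ≤ 8) (ha t)) (hw0 s t)
        rw [e]; linarith
    have hws : ∑ s ∈ I, ∑ t ∈ I, 8 * a t * w s t ≤ 16 * S := by
      rw [Finset.sum_comm, hSdef, Finset.mul_sum]
      refine Finset.sum_le_sum fun t _ => ?_
      rw [← Finset.mul_sum]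
      have := mul_le_mul_of_nonneg_left (sum_ite_pow_sub_le I t)
        (mul_nonneg (by norm_num : (0 : ℝ) ≤ 8) (ha t))
      linarith
    have hws' : ∑ s ∈ I, ∑ t ∈ I, 8 * a s * w t s ≤ 16 * S := by
      rw [Finset.sum_comm]; exact hws
    have hSS : ∑ s ∈ I, ∑ t ∈ I, 4 * a s * a t = 4 * S ^ 2 := by
      rw [sq, hSdef, Finset.sum_mul_sum, Finset.mul_sum]
      refine Finset.sum_congr rfl fun s _ => ?_
      rw [Finset.mul_sum]
      exact Finset.sum_congr rfl fun t _ => by ring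
    have htot : ∑ i ∈ I.sigma fareyBlock, ∑ j ∈ I.sigma fareyBlock,
        volume.real (fareyBall a i.1 i.2 ∩ fareyBall a j.1 j.2) =
        ∑ s ∈ I, ∑ t ∈ I, ∑ x ∈ fareyBlock s, ∑ y ∈ fareyBlock t,
          volume.real (fareyBall a s x ∩ fareyBall a t y) := by
      rw [Finset.sum_sigma]
      refine Finset.sum_congr rfl fun s _ => ?_
      exact (Finset.sum_congr rfl fun x _ => Finset.sum_sigma _ _ _).trans Finset.sum_comm
    rw [htot]
    refine (Finset.sum_le_sum fun s _ => Finset.sum_le_sum fun t _ => hpair s t).trans ?_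
    simp only [Finset.sum_add_distrib]
    nlinarith
  have h3 : (S / 16) ^ 2 ≤ volume.real (⋃ j ∈ I.sigma fareyBlock, fareyBall a j.1 j.2) *
      (36 * S ^ 2) :=
    (pow_le_pow_left₀ (by positivity) h1 2).trans
      (hmain.trans (mul_le_mul_of_nonneg_left h2 measureReal_nonneg))
  have hS2 : 0 < S ^ 2 := by positivity
  by_contra! h
  nlinarith

theorem fareyBall_subset_Ioo {a : ℕ → ℝ} (ha1 : ∀ t, a t ≤ 1) {t : ℕ} {x : ℕ × ℕ}
    (hx : x ∈ fareyBlock t) : fareyBall a t x ⊆ Set.Ioo 0 1 := by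
  obtain ⟨h1, h2, h3, -, -⟩ := mem_fareyBlock.1 hx
  intro z hz
  rw [fareyBall, Metric.mem_ball, Real.dist_eq, abs_lt] at hz
  have hq : (0 : ℝ) < x.2 := by exact_mod_cast (by omega : 0 < x.2)
  have hr : a t / 16 ^ t ≤ 1 / x.2 := by
    have e1 : (x.2 : ℝ) ≤ 16 ^ t := by
      have : x.2 ≤ 16 ^ t := h3.trans (Nat.pow_le_pow_left (by norm_num) t)
      exact_mod_cast this
    calc a t / 16 ^ t ≤ 1 / 16 ^ t := by gcongr; exact ha1 t
      _ ≤ 1 / x.2 := one_div_le_one_div_of_le hq e1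
  have l1 : 1 / (x.2 : ℝ) ≤ pairDiv x := by
    rw [pairDiv]; gcongr; exact_mod_cast h1
  have l2 : pairDiv x ≤ 1 - 1 / x.2 := by
    rw [pairDiv, one_sub_div hq.ne']
    have : (x.1 : ℝ) + 1 ≤ x.2 := by exact_mod_cast h2
    gcongr; linarith
  constructor <;> linarith [hz.1, hz.2]

/-- The points lying in `fareyBall a t x` for some `t > T` and `x ∈ fareyBlock t`. -/
noncomputable def fareyTail (a : ℕ → ℝ) (T : ℕ) : Set ℝ :=
  ⋃ t ∈ Set.Ioi T, ⋃ x ∈ fareyBlock t, fareyBall a t x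

theorem mem_fareyTail {a : ℕ → ℝ} {T : ℕ} {z : ℝ} :
    z ∈ fareyTail a T ↔ ∃ t > T, ∃ x ∈ fareyBlock t, z ∈ fareyBall a t x := by
  simp [fareyTail]

theorem measure_iInter_fareyTail_pos {a : ℕ → ℝ} (ha : ∀ t, 0 ≤ a t) (ha1 : ∀ t, a t ≤ 1)
    (hdiv : ∀ T, ∃ T', 1 ≤ ∑ t ∈ Ioc T T', a t) : 0 < volume (⋂ T, fareyTail a T) := by
  have hsub : ∀ T, fareyTail a T ⊆ Set.Ioo 0 1 := by
    intro T z hz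
    obtain ⟨t, -, x, hx, hz⟩ := mem_fareyTail.1 hz
    exact fareyBall_subset_Ioo ha1 hx hz
  have hfin : ∀ T, volume (fareyTail a T) ≠ ⊤ := fun T =>
    measure_ne_top_of_subset (hsub T) (by simp)
  have hopen : ∀ T, IsOpen (fareyTail a T) := fun T =>
    isOpen_biUnion fun t _ => isOpen_biUnion fun x _ => Metric.isOpen_ball
  have hanti : Antitone (fareyTail a) := by
    intro T T' hT z hz
    obtain ⟨t, ht, hz⟩ := mem_fareyTail.1 hz
    exact mem_fareyTail.2 ⟨t, lt_of_le_of_lt hT ht, hz⟩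
  have hlow : ∀ T, ENNReal.ofReal (1 / 9216) ≤ volume (fareyTail a T) := by
    intro T
    obtain ⟨T', hT'⟩ := hdiv T
    have h1 := le_measureReal_biUnion_fareyBall ha ha1 (I := Ioc T T')
      (fun t ht => by have := (mem_Ioc.1 ht).1; omega) hT'
    refine ENNReal.ofReal_le_of_le_toReal (h1.trans (measureReal_mono ?_ (hfin T)))
    refine Set.iUnion₂_subset fun j hj z hz => ?_
    obtain ⟨hj1, hj2⟩ := Finset.mem_sigma.1 hj
    exact mem_fareyTail.2 ⟨j.1, (mem_Ioc.1 hj1).1, j.2, hj2, hz⟩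
  have htend := tendsto_measure_iInter_atTop (μ := volume)
    (fun T => (hopen T).measurableSet.nullMeasurableSet) hanti ⟨0, hfin 0⟩
  exact lt_of_lt_of_le (ENNReal.ofReal_pos.2 (by norm_num))
    (ge_of_tendsto' htend hlow)

/-- The approximation function `n ↦ 1 / (n² (log n)^{0.9})`. -/
noncomputable def approxRadius (n : ℕ) : ℝ := 1 / ((n : ℝ) ^ 2 * Real.log n ^ (0.9 : ℝ))

/-- The function `t ↦ t^{-0.9} / 2`. -/
noncomputable def blockWeight (t : ℕ) : ℝ := (t : ℝ) ^ (-0.9 : ℝ) / 2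

theorem blockWeight_nonneg (t : ℕ) : 0 ≤ blockWeight t := by
  unfold blockWeight; positivity

theorem blockWeight_le_one (t : ℕ) : blockWeight t ≤ 1 := by
  rcases Nat.eq_zero_or_pos t with rfl | h
  · rw [blockWeight, Nat.cast_zero, Real.zero_rpow (by norm_num)]; norm_num
  · have : (t : ℝ) ^ (-0.9 : ℝ) ≤ 1 :=
      Real.rpow_le_one_of_one_le_of_nonpos (by exact_mod_cast h) (by norm_num)
    rw [blockWeight]; linarith

theorem exists_one_le_sum_blockWeight (T : ℕ) : ∃ T', 1 ≤ ∑ t ∈ Ioc T T', blockWeight t := by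
  have hns : ¬ Summable blockWeight := by
    intro h
    have h2 : Summable fun n : ℕ => (n : ℝ) ^ (-0.9 : ℝ) := by
      refine (h.mul_left 2).congr fun n => ?_
      rw [blockWeight]; ring
    have := Real.summable_nat_rpow.1 h2
    norm_num at this
  have ht := (not_summable_iff_tendsto_nat_atTop_of_nonneg blockWeight_nonneg).1 hns
  obtain ⟨N, hN1, hN2⟩ := ((ht.eventually_ge_atTop
    (1 + ∑ i ∈ range (T + 1), blockWeight i)).and (eventually_ge_atTop (T + 1))).exists
  have e : Ioc T (N - 1) = Ico (T + 1) N := by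
    ext; simp only [mem_Ioc, mem_Ico]; omega
  refine ⟨N - 1, ?_⟩
  rw [e, Finset.sum_Ico_eq_sub _ hN2]
  linarith

theorem blockWeight_div_le_approxRadius {t : ℕ} {x : ℕ × ℕ} (hx : x ∈ fareyBlock t) :
    blockWeight t / 16 ^ t ≤ approxRadius x.2 := by
  obtain ⟨h1, h2, h3, -, -⟩ := mem_fareyBlock.1 hx
  have hq1 : (1 : ℝ) < x.2 := by exact_mod_cast (by omega : 1 < x.2)
  have hq4 : (x.2 : ℝ) ≤ 4 ^ t := by exact_mod_cast h3
  have hlog : 0 < Real.log x.2 := Real.log_pos hq1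
  have hlogle : Real.log x.2 ≤ t * Real.log 4 := by
    rw [← Real.log_pow]; exact Real.log_le_log (by linarith) hq4
  have ht : (0 : ℝ) < t := by
    by_contra! h
    nlinarith [Real.log_pos (show (1 : ℝ) < 4 by norm_num)]
  have hlog4 : Real.log 4 ≤ 2 := by
    have : Real.log 4 = 2 * Real.log 2 := by
      rw [show (4 : ℝ) = 2 ^ 2 by norm_num, Real.log_pow]; norm_num
    linarith [Real.log_two_lt_d9]
  have hL : Real.log x.2 ^ (0.9 : ℝ) ≤ (t : ℝ) ^ (0.9 : ℝ) * 2 := by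
    calc Real.log x.2 ^ (0.9 : ℝ) ≤ (t * 2) ^ (0.9 : ℝ) :=
          Real.rpow_le_rpow hlog.le (by nlinarith) (by norm_num)
      _ = (t : ℝ) ^ (0.9 : ℝ) * 2 ^ (0.9 : ℝ) := Real.mul_rpow ht.le (by norm_num)
      _ ≤ (t : ℝ) ^ (0.9 : ℝ) * 2 := by
        refine mul_le_mul_of_nonneg_left ?_ (by positivity)
        calc (2 : ℝ) ^ (0.9 : ℝ) ≤ 2 ^ (1 : ℝ) :=
              Real.rpow_le_rpow_of_exponent_le (by norm_num) (by norm_num)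
          _ = 2 := Real.rpow_one 2
  have hq2 : (x.2 : ℝ) ^ 2 ≤ 16 ^ t := by
    calc (x.2 : ℝ) ^ 2 ≤ (4 ^ t) ^ 2 := by gcongr
      _ = 16 ^ t := by rw [← pow_mul, mul_comm, pow_mul]; norm_num
  have hLpos : 0 < Real.log x.2 ^ (0.9 : ℝ) := Real.rpow_pos_of_pos hlog _
  have htpos : 0 < (t : ℝ) ^ (0.9 : ℝ) := Real.rpow_pos_of_pos ht _
  have e : blockWeight t / 16 ^ t = 1 / (16 ^ t * ((t : ℝ) ^ (0.9 : ℝ) * 2)) := by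
    rw [blockWeight, Real.rpow_neg ht.le]
    field_simp
  rw [e, approxRadius]
  exact one_div_le_one_div_of_le (by positivity) (by gcongr)

theorem tendsto_approxRadius : Tendsto approxRadius atTop (nhds 0) := by
  refine squeeze_zero' (Eventually.of_forall fun n => ?_) ?_ tendsto_one_div_atTop_nhds_zero_nat
  · unfold approxRadius
    rcases Nat.eq_zero_or_pos n with rfl | h
    · simp
    · have := Real.log_nonneg (show (1 : ℝ) ≤ n by exact_mod_cast h)
      positivity
  · filter_upwards [(Real.tendsto_log_atTop.comp tendsto_natCast_atTop_atTop).eventually_ge_atTop 1,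
      eventually_ge_atTop 1] with n hn hn1
    have hn1' : (1 : ℝ) ≤ n := by exact_mod_cast hn1
    have h1 : 1 ≤ Real.log n ^ (0.9 : ℝ) := Real.one_le_rpow hn (by norm_num)
    exact one_div_le_one_div_of_le (by linarith) (by nlinarith)

theorem norm_coe_unitAddCircle_le (x : ℝ) : ‖(x : UnitAddCircle)‖ ≤ |x| := by
  rw [UnitAddCircle.norm_eq]
  simpa using round_le x 0

theorem coe_mem_addWellApproximable {z : ℝ} (hz : z ∈ ⋂ T, fareyTail blockWeight T) :
    (z : UnitAddCircle) ∈ addWellApproximable UnitAddCircle approxRadius := by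
  rw [UnitAddCircle.mem_addWellApproximable_iff]
  refine Set.infinite_of_forall_exists_gt fun N => ?_
  obtain ⟨t, ht, x, hx, hzx⟩ := mem_fareyTail.1 (Set.mem_iInter.1 hz (N + 1))
  obtain ⟨h1, h2, h3, h4, h5⟩ := mem_fareyBlock.1 hx
  refine ⟨x.2, ⟨x.1, h2, h5, ?_⟩, ?_⟩
  · rw [← AddCircle.coe_sub]
    refine (norm_coe_unitAddCircle_le _).trans_lt ?_
    rw [fareyBall, Metric.mem_ball, Real.dist_eq] at hzx
    exact hzx.trans_le (blockWeight_div_le_approxRadius hx)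
  · obtain ⟨s, rfl⟩ : ∃ s, t = s + 1 := ⟨t - 1, by omega⟩
    have : s < 4 ^ s := Nat.lt_pow_self (by norm_num)
    rw [pow_succ] at h4
    omega

/-- The divergence case of Khinchin's theorem for `approxRadius`. -/
theorem ae_coe_mem_addWellApproximable :
    ∀ᵐ α : ℝ ∂(volume.restrict (Set.Ico (0 : ℝ) 1)),
      (α : UnitAddCircle) ∈ addWellApproximable UnitAddCircle approxRadius := by
  have hmk := UnitAddCircle.measurePreserving_mk 0
  rw [zero_add] at hmk
  have hpos := measure_iInter_fareyTail_pos blockWeight_nonneg blockWeight_le_one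
    exists_one_le_sum_blockWeight
  rw [Measure.restrict_congr_set (Ico_ae_eq_Ioc (μ := volume) (a := (0 : ℝ)) (b := 1))]
  rcases AddCircle.addWellApproximable_ae_empty_or_univ (T := 1) approxRadius
    tendsto_approxRadius with h | h
  · exfalso
    have h1 := hmk.quasiMeasurePreserving.ae h
    rw [ae_restrict_iff' measurableSet_Ioc, ae_iff] at h1
    refine hpos.ne' (measure_mono_null (fun z hz => ?_) h1)
    have hz01 : z ∈ Set.Ioo (0 : ℝ) 1 := by
      obtain ⟨t, -, x, hx, hzx⟩ := mem_fareyTail.1 (Set.mem_iInter.1 hz 0)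
      exact fareyBall_subset_Ioo blockWeight_le_one hx hzx
    intro h2
    exact h2 ⟨hz01.1, hz01.2.le⟩ (coe_mem_addWellApproximable hz)
  · exact hmk.quasiMeasurePreserving.ae h

theorem nint_mul_le {α δ : ℝ} {m n : ℕ} (hn : 0 < n)
    (h : ‖(α : UnitAddCircle) - (((m : ℝ) / n : ℝ) : UnitAddCircle)‖ < δ) :
    nint (n * α) ≤ n * δ := by
  rw [← AddCircle.coe_sub, UnitAddCircle.norm_eq] at h
  set j := round (α - m / n)
  have hpos : (0 : ℝ) < n := by exact_mod_cast hn
  have h1 := round_le ((n : ℝ) * α) (m + n * j)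
  have e : (n : ℝ) * α - ((m + n * j : ℤ) : ℝ) = n * (α - m / n - j) := by
    push_cast; field_simp; ring
  rw [e, abs_mul, abs_of_pos hpos] at h1
  exact h1.trans (mul_le_mul_of_nonneg_left h.le hpos.le)

/-- There is `c > 0` such that for almost every `α ∈ [0,1)` there are infinitely many
`n` with both `G(n) ≥ c·n·(log n)^{1/4}/(log log n)` and `‖nα‖ ≤ 1/(n (log n)^{0.9})`. -/
theorem infinitely_many_good_n :
    ∃ c : ℝ, 0 < c ∧
      ∀ᵐ α ∂(volume.restrict (Set.Ico (0:ℝ) 1)),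
        {n : ℕ |
          c * (n : ℝ) * Real.log n ^ ((1:ℝ)/4) / Real.log (Real.log n) ≤ (G n : ℝ) ∧
          nint (n * α) ≤ 1 / ((n : ℝ) * Real.log n ^ ((0.9 : ℝ)))}.Infinite := by
  obtain ⟨c, hc, N₀, hG⟩ := exists_le_G
  refine ⟨c, hc, ?_⟩
  have hll : Tendsto (fun n : ℕ => Real.log (Real.log n)) atTop atTop :=
    Real.tendsto_log_atTop.comp (Real.tendsto_log_atTop.comp tendsto_natCast_atTop_atTop)
  obtain ⟨N₁, hN₁⟩ := eventually_atTop.1 (hll.eventually_ge_atTop 1)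
  filter_upwards [ae_coe_mem_addWellApproximable] with α hα
  rw [UnitAddCircle.mem_addWellApproximable_iff] at hα
  refine (hα.sdiff (Set.finite_lt_nat (max N₀ N₁))).mono ?_
  rintro n ⟨⟨m, hm, -, hmn⟩, hn⟩
  have hn' : max N₀ N₁ ≤ n := not_lt.1 hn
  have hn0 : 0 < n := by omega
  refine ⟨(div_le_self ?_ (hN₁ n (by omega))).trans (hG n (by omega)), ?_⟩
  · have := Real.log_natCast_nonneg n
    positivity
  · refine (nint_mul_le hn0 hmn).trans (le_of_eq ?_)
    have : (n : ℝ) ≠ 0 := by exact_mod_cast hn0.ne'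
    rw [approxRadius, sq, mul_assoc, ← one_div_mul_one_div, ← mul_assoc, mul_one_div_cancel this,
      one_mul]
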